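/- arXiv:1907.09144 — 7 statements merged into one kernel-verified Lean document; each statement's English description precedes it below -/
import Mathlib

section
/- (Breeden–Litzenberger) Let μ be a probability measure on [0,∞) with finite first moment, and define C(k) = ∫ (x−k)⁺ dμ(x) for k ≥ 0. Then for every x ≥ 0 the right derivative of C at x exists and equals μ([0,x]) − 1; that is, lim_{h→0+} (C(x+h) − C(x))/h = μ([0,x]) − 1. -/
open MeasureTheory

/-- The difference quotient of the call payoff `k ↦ (y - k)⁺` converges from the right to
`-1` if `x < y` and to `0` otherwise. -/
lemma tendsto_callPayoff_slope (x y : ℝ) :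
    Filter.Tendsto (fun h => (max (y - (x + h)) 0 - max (y - x) 0) / h)
      (nhdsWithin 0 (Set.Ioi 0)) (nhds ((Set.Ioi x).indicator (fun _ => (-1 : ℝ)) y)) := by
  refine tendsto_const_nhds.congr' ?_
  by_cases hxy : x < y
  · filter_upwards [Ioo_mem_nhdsGT (sub_pos.2 hxy)] with h hh
    obtain ⟨h0, h1⟩ := hh
    rw [Set.indicator_of_mem (Set.mem_Ioi.2 hxy), max_eq_left (by linarith),
      max_eq_left (by linarith)]
    field_simp
    ring
  · filter_upwards [self_mem_nhdsWithin] with h hh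
    have h0 : 0 < h := hh
    rw [Set.indicator_of_notMem (by simpa using hxy), max_eq_right (by linarith),
      max_eq_right (by linarith)]
    simp

lemma abs_callPayoff_slope_le_one (x y h : ℝ) :
    |(max (y - (x + h)) 0 - max (y - x) 0) / h| ≤ 1 := by
  rw [abs_div]
  refine div_le_one_of_le₀ ?_ (abs_nonneg h)
  refine (abs_max_sub_max_le_abs _ _ _).trans_eq ?_
  rw [show y - (x + h) - (y - x) = -h by ring, abs_neg]

/-- Breeden–Litzenberger: for a probability measure `μ` on `[0,∞)` with
finite first moment and call price function `C(k) = ∫ (x-k)⁺ dμ`, the right derivative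
of `C` at any `x ≥ 0` exists and equals `μ([0,x]) - 1`. -/
theorem breeden_litzenberger
    (μ : Measure ℝ) [IsProbabilityMeasure μ] (hsupp : μ (Set.Iio 0) = 0)
    (hint : Integrable (fun x => x) μ)
    (C : ℝ → ℝ) (hC : ∀ k, C k = ∫ x, max (x - k) 0 ∂μ)
    (x : ℝ) (hx : 0 ≤ x) :
    Filter.Tendsto (fun h => (C (x + h) - C x) / h) (nhdsWithin 0 (Set.Ioi 0))
      (nhds ((μ (Set.Icc 0 x)).toReal - 1)) := by
  have hI (k : ℝ) : Integrable (fun y => max (y - k) 0) μ :=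
    (hint.sub (integrable_const k)).pos_part
  have hslope (h : ℝ) : (C (x + h) - C x) / h =
      ∫ y, (max (y - (x + h)) 0 - max (y - x) 0) / h ∂μ := by
    rw [integral_div, integral_sub (hI _) (hI _), hC, hC]
  have hIcc : μ.real (Set.Icc 0 x) = μ.real (Set.Iic x) := by
    refine measureReal_congr ?_
    have h0 : ∀ᵐ y ∂μ, y ∉ Set.Iio (0 : ℝ) := measure_eq_zero_iff_ae_notMem.1 hsupp
    filter_upwards [h0] with y hy
    exact propext ⟨fun h => h.2, fun h => ⟨not_lt.1 hy, h⟩⟩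
  have hlim : ∫ y, (Set.Ioi x).indicator (fun _ => (-1 : ℝ)) y ∂μ =
      (μ (Set.Icc 0 x)).toReal - 1 := by
    rw [integral_indicator_const _ measurableSet_Ioi, ← Set.compl_Iic,
      probReal_compl_eq_one_sub measurableSet_Iic, ← hIcc, Measure.real, smul_eq_mul]
    ring
  simp_rw [hslope]
  rw [← hlim]
  refine tendsto_integral_filter_of_dominated_convergence (fun _ => 1) ?_ ?_
    (integrable_const 1) ?_
  · exact .of_forall fun h => (((hI _).sub (hI _)).div_const h).aestronglyMeasurable
  · exact .of_forall fun h => .of_forall fun y => abs_callPayoff_slope_le_one x y h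
  · exact .of_forall fun y => tendsto_callPayoff_slope x y
end

section
/- (Strassen) Let μ, ν be probability measures on [0,∞) with finite first moments. Then μ ≤_c ν if and only if there exists a probability measure Q on [0,∞)² whose first marginal is μ, whose second marginal is ν, and which satisfies the martingale condition: for every bounded measurable f : [0,∞) → ℝ, ∫ f(x)·(y − x) dQ(x,y) = 0. -/
open MeasureTheory Filter Topology Set
open scoped BoundedContinuousFunction CompactlySupported

section PositiveExtension

/-- A linear functional `L` that is nonnegative wherever `T` takes values in the cone `K` factors
through `T` as `g ∘ T` with `g` nonnegative on `K`, provided the range of `T` is cofinal. -/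
theorem exists_nonneg_linearMap_comp_eq {D E : Type*} [AddCommGroup D] [Module ℝ D]
    [AddCommGroup E] [Module ℝ E] (K : PointedCone ℝ E) (T : D →ₗ[ℝ] E) (L : D →ₗ[ℝ] ℝ)
    (hL : ∀ d, T d ∈ K → 0 ≤ L d) (hT : ∀ F, ∃ d, T d + F ∈ K) :
    ∃ g : E →ₗ[ℝ] ℝ, (∀ F ∈ K, 0 ≤ g F) ∧ ∀ d, g (T d) = L d := by
  let p : (D × E) →ₗ.[ℝ] ℝ :=
    { domain := Submodule.prod ⊤ ⊥
      toFun := (L ∘ₗ LinearMap.fst ℝ D E) ∘ₗ Submodule.subtype _ }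
  obtain ⟨g, hg, hpos⟩ := riesz_extension (K.comap (T.coprod LinearMap.id)) p
    (by
      rintro ⟨⟨d, F⟩, hd⟩ hK
      obtain rfl : F = 0 := by simpa [p] using hd
      exact hL d (by simpa using hK))
    (by
      rintro ⟨d, F⟩
      obtain ⟨d', hd'⟩ := hT (T d + F)
      exact ⟨⟨(d', 0), by simp [p]⟩, by simpa [add_assoc] using hd'⟩)
  have hgL (d : D) : g (d, 0) = L d := hg ⟨(d, 0), by simp [p]⟩
  refine ⟨g ∘ₗ LinearMap.inr ℝ D E, fun F hF ↦ hpos _ (by simpa [PointedCone.mem_comap] using hF),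
    fun d ↦ ?_⟩
  have h₁ : 0 ≤ g (d, - T d) := hpos _ (by simp [PointedCone.mem_comap])
  have h₂ : 0 ≤ g (-d, T d) := hpos _ (by simp [PointedCone.mem_comap])
  have e₁ : g (d, - T d) = g (d, 0) - g (0, T d) := by rw [← map_sub]; simp
  have e₂ : g (-d, T d) = g (0, T d) - g (d, 0) := by rw [← map_sub]; simp
  have : g (0, T d) = L d := by rw [← hgL]; linarith
  simpa using this

end PositiveExtension

section WeightedGrowth

variable {X : Type*} [TopologicalSpace X]

/-- The continuous functions dominated by a multiple of the weight `w`. -/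
def growthSubmodule (w : C(X, ℝ)) : Submodule ℝ C(X, ℝ) where
  carrier := {f | ∃ C, ∀ x, |f x| ≤ C * w x}
  zero_mem' := ⟨0, by simp⟩
  add_mem' := by
    rintro f g ⟨C, hC⟩ ⟨C', hC'⟩
    exact ⟨C + C', fun x ↦ (abs_add_le _ _).trans (by linarith [hC x, hC' x])⟩
  smul_mem' := by
    rintro c f ⟨C, hC⟩
    refine ⟨|c| * C, fun x ↦ ?_⟩
    simpa [abs_mul, mul_assoc] using mul_le_mul_of_nonneg_left (hC x) (abs_nonneg c)

theorem self_mem_growthSubmodule {w : C(X, ℝ)} (hw : ∀ x, 0 ≤ w x) : w ∈ growthSubmodule w :=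
  ⟨1, fun x ↦ by simp [abs_of_nonneg (hw x)]⟩

theorem mul_mem_growthSubmodule {w f τ : C(X, ℝ)} (hf : f ∈ growthSubmodule w)
    (hτ : ∀ x, |τ x| ≤ 1) : τ * f ∈ growthSubmodule w := by
  obtain ⟨C, hC⟩ := hf
  refine ⟨C, fun x ↦ le_trans ?_ (hC x)⟩
  simpa [abs_mul] using mul_le_of_le_one_left (abs_nonneg _) (hτ x)

theorem CompactlySupportedContinuousMap.mem_growthSubmodule {w : C(X, ℝ)} (hw : ∀ x, 1 ≤ w x)
    (f : C_c(X, ℝ)) : f.toContinuousMap ∈ growthSubmodule w := by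
  obtain ⟨C, hC⟩ := f.hasCompactSupport.exists_bound_of_continuous f.continuous
  refine ⟨C, fun x ↦ (hC x).trans (le_mul_of_one_le_right ?_ (hw x))⟩
  exact (norm_nonneg _).trans (hC x)

/-- A positive linear functional on the functions of growth at most `w` that does not charge
infinity is the integral against a measure. -/
theorem exists_measure_integral_eq_of_growth [T2Space X] [LocallyCompactSpace X]
    [MeasurableSpace X] [BorelSpace X] (w : C(X, ℝ)) (hw : ∀ x, 1 ≤ w x)
    (g : growthSubmodule w →ₗ[ℝ] ℝ) (hg : ∀ F : growthSubmodule w, (∀ x, 0 ≤ F.1 x) → 0 ≤ g F)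
    (τ : ℕ → C_c(X, ℝ)) (hτ₀ : ∀ n x, 0 ≤ τ n x) (hτ₁ : ∀ n x, τ n x ≤ 1)
    (hτ : ∀ x, Tendsto (fun n ↦ τ n x) atTop (𝓝 1)) (b : ℕ → growthSubmodule w)
    (hb : ∀ n x, (1 - τ n x) * w x ≤ (b n).1 x) (hb₀ : Tendsto (fun n ↦ g (b n)) atTop (𝓝 0)) :
    ∃ Q : Measure X, ∀ F : growthSubmodule w, Integrable F.1 Q ∧ ∫ x, F.1 x ∂Q = g F := by
  have hmono {F G : growthSubmodule w} (h : ∀ x, F.1 x ≤ G.1 x) : g F ≤ g G := by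
    have := hg (G - F) fun x ↦ by simpa using h x
    simpa using this
  let Λ : C_c(X, ℝ) →ₚ[ℝ] ℝ := PositiveLinearMap.mk₀
    { toFun := fun f ↦ g ⟨f.toContinuousMap, f.mem_growthSubmodule hw⟩
      map_add' := fun f f' ↦ by rw [← map_add]; rfl
      map_smul' := fun c f ↦ by rw [RingHom.id_apply, ← map_smul]; rfl }
    (fun f hf ↦ hg _ fun x ↦ hf x)
  let Q := RealRMK.rieszMeasure Λ
  have hτabs n x : |(τ n).toContinuousMap x| ≤ 1 :=
    (abs_of_nonneg (hτ₀ n x)).trans_le (hτ₁ n x)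
  let cut (n : ℕ) (F : growthSubmodule w) : growthSubmodule w :=
    ⟨(τ n).toContinuousMap * F.1, mul_mem_growthSubmodule F.2 (hτabs n)⟩
  have hcut n F x : (cut n F).1 x = τ n x * F.1 x := rfl
  have hcs n F : HasCompactSupport (cut n F).1 := (τ n).hasCompactSupport.mul_right
  have hint n F : ∫ x, (cut n F).1 x ∂Q = g (cut n F) :=
    RealRMK.integral_rieszMeasure Λ ⟨(cut n F).1, hcs n F⟩
  let W : growthSubmodule w := ⟨w, self_mem_growthSubmodule fun x ↦ zero_le_one.trans (hw x)⟩
  have hlim (F : growthSubmodule w) (x : X) :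
      Tendsto (fun n ↦ (cut n F).1 x) atTop (𝓝 (F.1 x)) := by
    simpa [hcut] using (hτ x).mul_const (F.1 x)
  have hcutint n F : Integrable (cut n F).1 Q :=
    (cut n F).1.continuous.integrable_of_hasCompactSupport (hcs n F)
  have hw₀ x : 0 ≤ w x := zero_le_one.trans (hw x)
  have hWint : Integrable w Q := by
    refine ⟨w.continuous.aestronglyMeasurable, ?_⟩
    have hliminf : ∫⁻ x, ‖w x‖ₑ ∂Q ≤ liminf (fun n ↦ ∫⁻ x, ‖(cut n W).1 x‖ₑ ∂Q) atTop :=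
      lintegral_congr (fun x ↦ (hlim W x).enorm.liminf_eq) ▸
        lintegral_liminf_le' fun n ↦ (hcutint n W).aestronglyMeasurable.enorm
    refine (hliminf.trans (liminf_le_of_frequently_le' (.of_forall fun n ↦ ?_))).trans_lt
      (ENNReal.ofReal_lt_top (r := g W))
    rw [← ofReal_integral_norm_eq_lintegral_enorm (hcutint n W)]
    refine ENNReal.ofReal_le_ofReal ?_
    have : ∫ x, ‖(cut n W).1 x‖ ∂Q = g (cut n W) := by
      rw [← hint]
      exact integral_congr_ae (ae_of_all _ fun x ↦ abs_of_nonneg (mul_nonneg (hτ₀ n x) (hw₀ x)))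
    rw [this]
    exact hmono fun x ↦ mul_le_of_le_one_left (hw₀ x) (hτ₁ n x)
  refine ⟨Q, fun F ↦ ?_⟩
  obtain ⟨C, hC⟩ := F.2
  have hFint : Integrable F.1 Q :=
    (hWint.const_mul C).mono' F.1.continuous.aestronglyMeasurable (ae_of_all _ hC)
  refine ⟨hFint, ?_⟩
  have h₁ : Tendsto (fun n ↦ g (cut n F)) atTop (𝓝 (∫ x, F.1 x ∂Q)) := by
    simp_rw [← hint]
    refine tendsto_integral_of_dominated_convergence (fun x ↦ |F.1 x|)
      (fun n ↦ (hcutint n F).aestronglyMeasurable) hFint.abs (fun n ↦ ae_of_all _ fun x ↦ ?_)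
      (ae_of_all _ (hlim F))
    rw [Real.norm_eq_abs, hcut, abs_mul]
    exact mul_le_of_le_one_left (abs_nonneg _) (hτabs n x)
  have hC₀ (x : X) : 0 ≤ C := by
    have := (abs_nonneg _).trans (hC x)
    nlinarith [hw x]
  have hle n x : |F.1 x - (cut n F).1 x| ≤ C * (b n).1 x := by
    have : F.1 x - (cut n F).1 x = (1 - τ n x) * F.1 x := by rw [hcut]; ring
    rw [this, abs_mul, abs_of_nonneg (sub_nonneg.2 (hτ₁ n x))]
    calc (1 - τ n x) * |F.1 x| ≤ (1 - τ n x) * (C * w x) :=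
          mul_le_mul_of_nonneg_left (hC x) (sub_nonneg.2 (hτ₁ n x))
      _ = C * ((1 - τ n x) * w x) := by ring
      _ ≤ _ := mul_le_mul_of_nonneg_left (hb n x) (hC₀ x)
  have h₂ : Tendsto (fun n ↦ g F - g (cut n F)) atTop (𝓝 0) := by
    refine squeeze_zero_norm (fun n ↦ ?_) (by simpa using hb₀.const_mul C)
    rw [Real.norm_eq_abs, ← map_sub, ← smul_eq_mul, ← map_smul, abs_le, ← map_neg]
    exact ⟨hmono fun x ↦ (abs_le.1 (hle n x)).1, hmono fun x ↦ (abs_le.1 (hle n x)).2⟩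
  have h₃ : Tendsto (fun n ↦ g (cut n F)) atTop (𝓝 (g F)) := by
    simpa using h₂.const_sub (g F)
  exact tendsto_nhds_unique h₁ h₃

end WeightedGrowth

section ConvexOrder

variable {μ ν : Measure ℝ}

/-- Weak duality for martingale couplings: if `φ x + ψ y + h x * (y - x)` is nonnegative, then
convex order forces `∫ φ dμ + ∫ ψ dν` to be nonnegative. -/
theorem integral_add_integral_nonneg_of_convexOrder [IsProbabilityMeasure μ]
    [IsProbabilityMeasure ν]
    (hμ : Integrable (fun x ↦ x) μ) (hν : Integrable (fun x ↦ x) ν)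
    (hord : ∀ f : ℝ → ℝ, ConvexOn ℝ univ f → Integrable f μ → Integrable f ν →
      ∫ x, f x ∂μ ≤ ∫ x, f x ∂ν)
    {φ ψ h : ℝ → ℝ} (hφ : Integrable φ μ) (hψμ : Integrable ψ μ) (hψν : Integrable ψ ν)
    (H : ∀ x y, 0 ≤ φ x + ψ y + h x * (y - x)) :
    0 ≤ ∫ x, φ x ∂μ + ∫ y, ψ y ∂ν := by
  let f (y : ℝ) : ℝ := ⨆ x, (-φ x - h x * (y - x))
  have hbdd y : BddAbove (range fun x ↦ -φ x - h x * (y - x)) :=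
    ⟨ψ y, by rintro _ ⟨x, rfl⟩; linarith [H x y]⟩
  have hle x y : -φ x - h x * (y - x) ≤ f y := le_ciSup (hbdd y) x
  have hfψ y : f y ≤ ψ y := ciSup_le fun x ↦ by linarith [H x y]
  have hconv : ConvexOn ℝ univ f := by
    refine ⟨convex_univ, fun y _ z _ a b ha hb hab ↦ ciSup_le fun x ↦ ?_⟩
    simp only [smul_eq_mul]
    have h₁ := mul_le_mul_of_nonneg_left (hle x y) ha
    have h₂ := mul_le_mul_of_nonneg_left (hle x z) hb
    obtain rfl : b = 1 - a := by linarith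
    linarith
  have hcont : Continuous f := continuousOn_univ.1 (hconv.continuousOn isOpen_univ)
  have hint {ρ : Measure ℝ} [IsProbabilityMeasure ρ] (hρ : Integrable (fun x ↦ x) ρ)
      (hψ : Integrable ψ ρ) : Integrable f ρ :=
    integrable_of_le_of_le hcont.aestronglyMeasurable (ae_of_all _ (hle 0)) (ae_of_all _ hfψ)
      ((integrable_const _).sub ((hρ.sub (integrable_const _)).const_mul _)) hψ
  have h₁ : ∫ x, -φ x ∂μ ≤ ∫ x, f x ∂μ :=
    integral_mono hφ.neg (hint hμ hψμ) fun x ↦ by simpa using hle x x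
  have h₂ : ∫ x, f x ∂ν ≤ ∫ x, ψ x ∂ν := integral_mono (hint hν hψν) hψν hfψ
  rw [integral_neg] at h₁
  linarith [hord f hconv (hint hμ hψμ) (hint hν hψν)]

/-- A convex function on the line has a measurable (indeed monotone) selection of slopes of
supporting lines. -/
theorem ConvexOn.exists_measurable_subgradient {f : ℝ → ℝ} (hf : ConvexOn ℝ univ f) :
    ∃ m : ℝ → ℝ, Measurable m ∧ ∀ x y, f x + m x * (y - x) ≤ f y := by
  refine ⟨fun x ↦ derivWithin f (Ioi x) x, ?_, fun x y ↦ ?_⟩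
  · have : Monotone fun x ↦ derivWithin f (Ioi x) x := by
      simpa [monotoneOn_univ] using hf.monotoneOn_rightDeriv
    exact this.measurable
  · have hx : x ∈ interior (univ : Set ℝ) := by simp
    rcases lt_trichotomy x y with h | rfl | h
    · have := hf.rightDeriv_le_slope_of_mem_interior hx (mem_univ y) h
      rw [slope_def_field, le_div_iff₀ (by linarith)] at this
      linarith
    · simp
    · have := (hf.slope_le_leftDeriv_of_mem_interior (mem_univ y) hx h).trans
        (hf.leftDeriv_le_rightDeriv_of_mem_interior hx)
      rw [slope_def_field, div_le_iff₀ (by linarith)] at this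
      linarith

/-- The marginals of a martingale coupling are in convex order. -/
theorem integral_le_integral_of_martingale_coupling {Q : Measure (ℝ × ℝ)}
    [IsFiniteMeasure Q] (hfst : Q.map Prod.fst = μ) (hsnd : Q.map Prod.snd = ν)
    (hμ : Integrable (fun x ↦ x) μ) (hν : Integrable (fun x ↦ x) ν)
    (hmart : ∀ f : ℝ → ℝ, Measurable f → (∃ B : ℝ, ∀ x, |f x| ≤ B) →
      ∫ p : ℝ × ℝ, f p.1 * (p.2 - p.1) ∂Q = 0)
    {f : ℝ → ℝ} (hf : ConvexOn ℝ univ f) (hfμ : Integrable f μ) (hfν : Integrable f ν) :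
    ∫ x, f x ∂μ ≤ ∫ x, f x ∂ν := by
  subst hfst hsnd
  have i₁ : Integrable (fun p : ℝ × ℝ ↦ f p.1) Q := hfμ.comp_measurable measurable_fst
  have i₂ : Integrable (fun p : ℝ × ℝ ↦ f p.2) Q := hfν.comp_measurable measurable_snd
  have hsub : Integrable (fun p : ℝ × ℝ ↦ p.2 - p.1) Q :=
    (hν.comp_measurable measurable_snd).sub (hμ.comp_measurable measurable_fst)
  rw [integral_map measurable_fst.aemeasurable hfμ.aestronglyMeasurable,
    integral_map measurable_snd.aemeasurable hfν.aestronglyMeasurable, ← sub_nonneg,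
    ← integral_sub i₂ i₁]
  obtain ⟨m, hm, hsupp⟩ := hf.exists_measurable_subgradient
  let A (n : ℕ) : Set ℝ := {x | |m x| ≤ n}
  have hA n : MeasurableSet (A n) := measurableSet_le hm.abs measurable_const
  have hlim : Tendsto (fun n ↦ ∫ p : ℝ × ℝ, (A n).indicator 1 p.1 * (f p.2 - f p.1) ∂Q) atTop
      (𝓝 (∫ p : ℝ × ℝ, f p.2 - f p.1 ∂Q)) := by
    refine tendsto_integral_of_dominated_convergence (fun p ↦ |f p.2 - f p.1|) (fun n ↦ ?_)
      (i₂.sub i₁).abs (fun n ↦ ae_of_all _ fun p ↦ ?_) (ae_of_all _ fun p ↦ ?_)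
    · exact ((measurable_one.indicator (hA n)).comp measurable_fst).aestronglyMeasurable.mul
        (i₂.sub i₁).aestronglyMeasurable
    · by_cases h : p.1 ∈ A n <;> simp [h]
    · refine tendsto_const_nhds.congr' ?_
      filter_upwards [eventually_ge_atTop ⌈|m p.1|⌉₊] with n hn
      have : p.1 ∈ A n := Nat.ceil_le.1 hn
      simp [this]
  refine ge_of_tendsto' hlim fun n ↦ ?_
  have hbound x : |(A n).indicator m x| ≤ n := by
    by_cases h : x ∈ A n
    · rw [indicator_of_mem h]
      exact h
    · simp [h]
  rw [← hmart _ (hm.indicator (hA n)) ⟨n, hbound⟩]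
  refine integral_mono ?_ ?_ fun p ↦ ?_
  · exact hsub.bdd_mul ((hm.indicator (hA n)).comp measurable_fst).aestronglyMeasurable
      (ae_of_all _ fun p ↦ hbound p.1)
  · refine (i₂.sub i₁).bdd_mul (c := 1)
      ((measurable_one.indicator (hA n)).comp measurable_fst).aestronglyMeasurable
      (ae_of_all _ fun p ↦ ?_)
    by_cases h : p.1 ∈ A n <;> simp [h]
  · by_cases h : p.1 ∈ A n
    · simpa [h] using by linarith [hsupp p.1 p.2]
    · simp [h]

end ConvexOrder

section MartingaleCoupling

/-- Orthogonality to bounded continuous functions of the first coordinate extends to bounded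
measurable functions of the first coordinate. -/
theorem integral_comp_fst_mul_eq_zero_of_boundedContinuous {Q : Measure (ℝ × ℝ)}
    {k : ℝ × ℝ → ℝ} (hk : Measurable k) (hkQ : Integrable k Q)
    (H : ∀ h : ℝ →ᵇ ℝ, ∫ p, h p.1 * k p ∂Q = 0) {f : ℝ → ℝ} (hf : Measurable f) {B : ℝ}
    (hB : ∀ x, |f x| ≤ B) :
    ∫ p, f p.1 * k p ∂Q = 0 := by
  let ρ (l : ℝ × ℝ → ℝ) : Measure ℝ := (Q.withDensity fun p ↦ ENNReal.ofReal (l p)).map Prod.fst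
  have hρ {l : ℝ × ℝ → ℝ} (hl : Measurable l) {h : ℝ → ℝ} (hh : Measurable h) :
      ∫ x, h x ∂(ρ l) = ∫ p, h p.1 * max (l p) 0 ∂Q := by
    rw [integral_map measurable_fst.aemeasurable hh.aestronglyMeasurable,
      integral_withDensity_eq_integral_toReal_smul hl.ennreal_ofReal (by simp)]
    simp [ENNReal.toReal_ofReal', mul_comm]
  have hfin {l : ℝ × ℝ → ℝ} (hl : Integrable l Q) : IsFiniteMeasure (ρ l) := by
    have := isFiniteMeasure_withDensity_ofReal hl.2
    infer_instance
  have hdiff {h : ℝ → ℝ} (hh : Measurable h) {C : ℝ} (hC : ∀ x, |h x| ≤ C) :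
      ∫ x, h x ∂(ρ k) - ∫ x, h x ∂(ρ (-k)) = ∫ p, h p.1 * k p ∂Q := by
    have hi {l : ℝ × ℝ → ℝ} (hl : Integrable l Q) :
        Integrable (fun p ↦ h p.1 * max (l p) 0) Q :=
      hl.pos_part.bdd_mul (hh.comp measurable_fst).aestronglyMeasurable
        (ae_of_all _ fun p ↦ hC p.1)
    rw [hρ hk hh, hρ hk.neg hh, ← integral_sub (hi hkQ) (hi hkQ.neg)]
    refine integral_congr_ae (ae_of_all _ fun p ↦ ?_)
    dsimp only [Pi.neg_apply]
    rw [← mul_sub, max_zero_sub_eq_self]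
  have := hfin hkQ
  have := hfin hkQ.neg
  have heq : ρ k = ρ (-k) := ext_of_forall_integral_eq_of_IsFiniteMeasure fun h ↦ by
    rw [← sub_eq_zero, hdiff h.continuous.measurable h.norm_coe_le_norm, H h]
  rw [← hdiff hf hB, heq, sub_self]

/-- The weight `1 + |x|` on the line. -/
def lineWeight : C(ℝ, ℝ) where
  toFun x := 1 + |x|

/-- The weight `1 + |x| + |y|` on the plane. -/
def planeWeight : C(ℝ × ℝ, ℝ) where
  toFun p := 1 + |p.1| + |p.2|

theorem integrable_of_mem_growthSubmodule_lineWeight {μ : Measure ℝ} [IsFiniteMeasure μ]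
    (hμ : Integrable (fun x ↦ x) μ) (φ : growthSubmodule lineWeight) : Integrable φ.1 μ := by
  obtain ⟨C, hC⟩ := φ.2
  exact (((integrable_const 1).add hμ.abs).const_mul C).mono'
    φ.1.continuous.aestronglyMeasurable (ae_of_all _ hC)

/-- The function `φ x + ψ y + h x * (y - x)` attached to a dual triple `(φ, ψ, h)`. -/
def martingaleDualMap :
    growthSubmodule lineWeight × growthSubmodule lineWeight × (ℝ →ᵇ ℝ) →ₗ[ℝ]
      growthSubmodule planeWeight where
  toFun d := ⟨⟨fun p ↦ d.1.1 p.1 + d.2.1.1 p.2 + d.2.2 p.1 * (p.2 - p.1), by fun_prop⟩, by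
    obtain ⟨⟨φ, C, hC⟩, ⟨ψ, C', hC'⟩, h⟩ := d
    refine ⟨|C| + |C'| + ‖h‖, fun p ↦ ?_⟩
    have h₁ : |φ p.1| ≤ |C| * (1 + |p.1|) :=
      (hC p.1).trans
        (mul_le_mul_of_nonneg_right (le_abs_self C) (add_nonneg zero_le_one (abs_nonneg _)))
    have h₂ : |ψ p.2| ≤ |C'| * (1 + |p.2|) :=
      (hC' p.2).trans
        (mul_le_mul_of_nonneg_right (le_abs_self C') (add_nonneg zero_le_one (abs_nonneg _)))
    have h₃ : |h p.1 * (p.2 - p.1)| ≤ ‖h‖ * (|p.1| + |p.2|) := by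
      rw [abs_mul, add_comm |p.1|]
      exact mul_le_mul (h.norm_coe_le_norm _) (abs_sub _ _) (abs_nonneg _) (norm_nonneg _)
    calc |φ p.1 + ψ p.2 + h p.1 * (p.2 - p.1)|
        ≤ |φ p.1| + |ψ p.2| + |h p.1 * (p.2 - p.1)| := abs_add_three _ _ _
      _ ≤ |C| * (1 + |p.1|) + |C'| * (1 + |p.2|) + ‖h‖ * (|p.1| + |p.2|) := by gcongr
      _ ≤ (|C| + |C'| + ‖h‖) * (1 + |p.1| + |p.2|) := by
        have := mul_nonneg (abs_nonneg C) (abs_nonneg p.2)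
        have := mul_nonneg (abs_nonneg C') (abs_nonneg p.1)
        linarith [norm_nonneg h]⟩
  map_add' d d' := by
    ext p
    simp
    ring
  map_smul' c d := by
    ext p
    simp
    ring

theorem martingaleDualMap_apply (φ ψ : growthSubmodule lineWeight) (h : ℝ →ᵇ ℝ) (p : ℝ × ℝ) :
    (martingaleDualMap (φ, ψ, h)).1 p = φ.1 p.1 + ψ.1 p.2 + h p.1 * (p.2 - p.1) :=
  rfl

/-- The dual objective `∫ φ dμ + ∫ ψ dν` as a linear functional. -/
noncomputable def martingaleDualValue (μ ν : Measure ℝ) [IsFiniteMeasure μ] [IsFiniteMeasure ν]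
    (hμ : Integrable (fun x ↦ x) μ) (hν : Integrable (fun x ↦ x) ν) :
    growthSubmodule lineWeight × growthSubmodule lineWeight × (ℝ →ᵇ ℝ) →ₗ[ℝ] ℝ where
  toFun d := ∫ x, d.1.1 x ∂μ + ∫ y, d.2.1.1 y ∂ν
  map_add' d d' := by
    have h₁ := integral_add (integrable_of_mem_growthSubmodule_lineWeight hμ d.1)
      (integrable_of_mem_growthSubmodule_lineWeight hμ d'.1)
    have h₂ := integral_add (integrable_of_mem_growthSubmodule_lineWeight hν d.2.1)
      (integrable_of_mem_growthSubmodule_lineWeight hν d'.2.1)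
    simp only [Prod.fst_add, Prod.snd_add, Submodule.coe_add, ContinuousMap.add_apply, h₁, h₂]
    ring
  map_smul' c d := by
    simp [integral_const_mul, mul_add]

/-- The cutoff equal to `1` on the ball of radius `2 (n + 1)` and vanishing off that of radius
`3 (n + 1)`. -/
noncomputable def planeCutoff (n : ℕ) : C_c(ℝ × ℝ, ℝ) where
  toFun p := max 0 (min 1 (3 - ‖p‖ / (n + 1)))
  continuous_toFun := by fun_prop
  hasCompactSupport' := by
    refine .intro (isCompact_closedBall 0 (3 * (n + 1 : ℝ))) fun p hp ↦ ?_
    have hp : 3 * (n + 1 : ℝ) < ‖p‖ := by simpa using hp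
    have : 3 ≤ ‖p‖ / (n + 1) := (le_div_iff₀ (by positivity)).2 hp.le
    exact max_eq_left ((min_le_right _ _).trans (by linarith))

theorem planeCutoff_apply (n : ℕ) (p : ℝ × ℝ) :
    planeCutoff n p = max 0 (min 1 (3 - ‖p‖ / (n + 1))) :=
  rfl

theorem planeCutoff_eq_one {n : ℕ} {p : ℝ × ℝ} (hp : ‖p‖ ≤ 2 * (n + 1)) :
    planeCutoff n p = 1 := by
  have : ‖p‖ / (n + 1) ≤ 2 := (div_le_iff₀ (by positivity)).2 hp
  rw [planeCutoff_apply, min_eq_left (by linarith), max_eq_right zero_le_one]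

/-- Six times the excess of `|x|` over `n + 1`. -/
noncomputable def lineTail (n : ℕ) : growthSubmodule lineWeight :=
  ⟨⟨fun x ↦ 6 * max 0 (|x| - (n + 1)), by fun_prop⟩, 6, fun x ↦ by
    have : |6 * max 0 (|x| - (n + 1))| = 6 * max 0 (|x| - (n + 1)) := abs_of_nonneg (by positivity)
    refine this.trans_le (mul_le_mul_of_nonneg_left (max_le ?_ ?_) (by norm_num))
    · exact add_nonneg zero_le_one (abs_nonneg x)
    · change |x| - (n + 1) ≤ 1 + |x|
      linarith [n.cast_nonneg (α := ℝ)]⟩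

theorem lineTail_apply (n : ℕ) (x : ℝ) : (lineTail n).1 x = 6 * max 0 (|x| - (n + 1)) :=
  rfl

theorem tendsto_integral_lineTail {μ : Measure ℝ} (hμ : Integrable (fun x ↦ x) μ) :
    Tendsto (fun n ↦ ∫ x, (lineTail n).1 x ∂μ) atTop (𝓝 0) := by
  rw [← integral_zero ℝ ℝ (μ := μ)]
  refine tendsto_integral_of_dominated_convergence (fun x ↦ 6 * |x|)
    (fun n ↦ (lineTail n).1.continuous.aestronglyMeasurable) (hμ.abs.const_mul 6)
    (fun n ↦ ae_of_all _ fun x ↦ ?_) (ae_of_all _ fun x ↦ ?_)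
  · rw [lineTail_apply, Real.norm_of_nonneg (by positivity)]
    exact mul_le_mul_of_nonneg_left
      (max_le (abs_nonneg x) (by linarith [n.cast_nonneg (α := ℝ)])) (by norm_num)
  · refine tendsto_const_nhds.congr' ?_
    filter_upwards [eventually_ge_atTop ⌈|x|⌉₊] with n hn
    have : |x| ≤ n := Nat.ceil_le.1 hn
    rw [lineTail_apply, max_eq_left (by linarith), mul_zero]

theorem one_sub_planeCutoff_mul_planeWeight_le (n : ℕ) (p : ℝ × ℝ) :
    (1 - planeCutoff n p) * planeWeight p ≤ (lineTail n).1 p.1 + (lineTail n).1 p.2 := by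
  have hw : planeWeight p = 1 + |p.1| + |p.2| := rfl
  rw [lineTail_apply, lineTail_apply]
  have hm₁ := le_max_left 0 (|p.1| - (n + 1))
  have hm₂ := le_max_left 0 (|p.2| - (n + 1))
  rcases le_or_gt ‖p‖ (2 * (n + 1)) with hp | hp
  · rw [planeCutoff_eq_one hp]
    linarith
  · have hτ : 0 ≤ planeCutoff n p := le_max_left _ _
    have hle : (1 - planeCutoff n p) * planeWeight p ≤ planeWeight p :=
      mul_le_of_le_one_left (by rw [hw]; positivity) (by linarith)
    have hn : (0 : ℝ) ≤ n := n.cast_nonneg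
    have h₁ := le_max_right 0 (|p.1| - (n + 1))
    have h₂ := le_max_right 0 (|p.2| - (n + 1))
    rw [Prod.norm_def, lt_max_iff, Real.norm_eq_abs, Real.norm_eq_abs] at hp
    rcases le_total |p.1| |p.2| with h | h <;> rcases hp with hp | hp <;> linarith

/-- Probability measures in convex order admit a martingale coupling. -/
theorem exists_martingale_coupling_of_convexOrder {μ ν : Measure ℝ} [IsProbabilityMeasure μ]
    [IsProbabilityMeasure ν] (hμ : Integrable (fun x ↦ x) μ) (hν : Integrable (fun x ↦ x) ν)
    (hord : ∀ f : ℝ → ℝ, ConvexOn ℝ univ f → Integrable f μ → Integrable f ν →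
      ∫ x, f x ∂μ ≤ ∫ x, f x ∂ν) :
    ∃ Q : Measure (ℝ × ℝ), Q.map Prod.fst = μ ∧ Q.map Prod.snd = ν ∧
      ∀ f : ℝ → ℝ, Measurable f → (∃ B : ℝ, ∀ x, |f x| ≤ B) →
        ∫ p : ℝ × ℝ, f p.1 * (p.2 - p.1) ∂Q = 0 := by
  let K : PointedCone ℝ (growthSubmodule planeWeight) :=
    { carrier := {F | ∀ p, 0 ≤ F.1 p}
      zero_mem' := fun p ↦ le_rfl
      add_mem' := fun hF hG p ↦ add_nonneg (hF p) (hG p)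
      smul_mem' := fun c F hF p ↦ mul_nonneg c.2 (hF p) }
  obtain ⟨g, hgK, hgL⟩ := exists_nonneg_linearMap_comp_eq K martingaleDualMap
    (martingaleDualValue μ ν hμ hν)
    (fun d hd ↦ integral_add_integral_nonneg_of_convexOrder hμ hν hord (h := d.2.2)
      (integrable_of_mem_growthSubmodule_lineWeight hμ d.1)
      (integrable_of_mem_growthSubmodule_lineWeight hμ d.2.1)
      (integrable_of_mem_growthSubmodule_lineWeight hν d.2.1) fun x y ↦ hd (x, y))
    (by
      rintro ⟨F, C, hC⟩
      let φ : growthSubmodule lineWeight :=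
        ⟨lineWeight, self_mem_growthSubmodule fun x ↦ add_nonneg zero_le_one (abs_nonneg x)⟩
      refine ⟨(|C| • φ, |C| • φ, 0), fun p ↦ ?_⟩
      have h₁ : |F p| ≤ C * (1 + |p.1| + |p.2|) := hC p
      have h₂ : C * (1 + |p.1| + |p.2|) ≤ |C| * (1 + |p.1| + |p.2|) :=
        mul_le_mul_of_nonneg_right (le_abs_self C) (by positivity)
      change 0 ≤ |C| * (1 + |p.1|) + |C| * (1 + |p.2|) + 0 * (p.2 - p.1) + F p
      linarith [neg_abs_le (F p), abs_nonneg C])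
  obtain ⟨Q, hQ⟩ := exists_measure_integral_eq_of_growth planeWeight
    (fun p ↦ by
      change 1 ≤ 1 + |p.1| + |p.2|
      linarith [abs_nonneg p.1, abs_nonneg p.2])
    g hgK planeCutoff (fun n p ↦ le_max_left _ _)
    (fun n p ↦ max_le zero_le_one (min_le_left _ _))
    (fun p ↦ by
      refine tendsto_const_nhds.congr' ?_
      filter_upwards [eventually_ge_atTop ⌈‖p‖⌉₊] with n hn
      have : ‖p‖ ≤ n := Nat.ceil_le.1 hn
      exact (planeCutoff_eq_one (by linarith [n.cast_nonneg (α := ℝ)])).symm)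
    (fun n ↦ martingaleDualMap (lineTail n, lineTail n, 0))
    (fun n p ↦ (one_sub_planeCutoff_mul_planeWeight_le n p).trans
      (by simp [martingaleDualMap_apply]))
    (by
      simp_rw [hgL]
      simpa [martingaleDualValue] using
        (tendsto_integral_lineTail hμ).add (tendsto_integral_lineTail hν))
  have hdual (φ ψ : growthSubmodule lineWeight) (h : ℝ →ᵇ ℝ) :
      Integrable (fun p : ℝ × ℝ ↦ φ.1 p.1 + ψ.1 p.2 + h p.1 * (p.2 - p.1)) Q ∧
      ∫ p, φ.1 p.1 + ψ.1 p.2 + h p.1 * (p.2 - p.1) ∂Q = ∫ x, φ.1 x ∂μ + ∫ y, ψ.1 y ∂ν :=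
    ⟨(hQ (martingaleDualMap (φ, ψ, h))).1, (hQ _).2.trans (hgL (φ, ψ, h))⟩
  have hbdd (f : ℝ →ᵇ ℝ) : f.toContinuousMap ∈ growthSubmodule lineWeight :=
    ⟨‖f‖, fun x ↦ (f.norm_coe_le_norm x).trans
      (le_mul_of_one_le_right (norm_nonneg f) (le_add_of_nonneg_right (abs_nonneg x)))⟩
  have hfin : IsFiniteMeasure Q := by
    have := (hdual ⟨_, hbdd (.const ℝ 1)⟩ 0 0).1
    simpa [integrable_const_iff] using this
  have hsub : Integrable (fun p : ℝ × ℝ ↦ p.2 - p.1) Q := by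
    simpa using (hdual 0 0 (.const ℝ 1)).1
  refine ⟨Q, ext_of_forall_integral_eq_of_IsFiniteMeasure fun f ↦ ?_,
    ext_of_forall_integral_eq_of_IsFiniteMeasure fun f ↦ ?_, fun f hf ⟨B, hB⟩ ↦ ?_⟩
  · rw [integral_map measurable_fst.aemeasurable f.continuous.aestronglyMeasurable]
    simpa using (hdual ⟨_, hbdd f⟩ 0 0).2
  · rw [integral_map measurable_snd.aemeasurable f.continuous.aestronglyMeasurable]
    simpa using (hdual 0 ⟨_, hbdd f⟩ 0).2
  · refine integral_comp_fst_mul_eq_zero_of_boundedContinuous (by fun_prop) hsub (fun h ↦ ?_) hf hB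
    simpa using (hdual 0 0 h).2

end MartingaleCoupling

/-- Strassen: for probability measures `μ, ν` on `[0,∞)` with finite first
moments, `μ ≤_c ν` (convex order) holds if and only if there is a martingale coupling `Q`
of `μ` and `ν`, i.e. a probability measure on `[0,∞)²` with first marginal `μ`, second
marginal `ν`, such that `∫ f(x)(y - x) dQ(x,y) = 0` for every bounded measurable `f`. -/
theorem strassen_convex_order_iff_martingale_coupling
    (μ ν : Measure ℝ) [IsProbabilityMeasure μ] [IsProbabilityMeasure ν]
    (hμsupp : μ (Set.Iio 0) = 0) (hνsupp : ν (Set.Iio 0) = 0)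
    (hμint : Integrable (fun x => x) μ) (hνint : Integrable (fun x => x) ν) :
    (∀ f : ℝ → ℝ, ConvexOn ℝ Set.univ f → Integrable f μ → Integrable f ν →
        ∫ x, f x ∂μ ≤ ∫ x, f x ∂ν) ↔
    (∃ Q : Measure (ℝ × ℝ), IsProbabilityMeasure Q ∧
        Q {p : ℝ × ℝ | p.1 < 0 ∨ p.2 < 0} = 0 ∧
        Q.map Prod.fst = μ ∧ Q.map Prod.snd = ν ∧
        ∀ f : ℝ → ℝ, Measurable f → (∃ B : ℝ, ∀ x, |f x| ≤ B) →
          ∫ p : ℝ × ℝ, f p.1 * (p.2 - p.1) ∂Q = 0) := by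
  constructor
  · intro hord
    obtain ⟨Q, rfl, rfl, hmart⟩ := exists_martingale_coupling_of_convexOrder hμint hνint hord
    refine ⟨Q, ⟨?_⟩, ?_, rfl, rfl, hmart⟩
    · simpa [Measure.map_apply measurable_fst] using measure_univ (μ := Q.map Prod.fst)
    · rw [Measure.map_apply measurable_fst measurableSet_Iio] at hμsupp
      rw [Measure.map_apply measurable_snd measurableSet_Iio] at hνsupp
      exact measure_union_null hμsupp hνsupp
  · rintro ⟨Q, hQ, -, hfst, hsnd, hmart⟩ f hf hfμ hfν
    exact integral_le_integral_of_martingale_coupling hfst hsnd hμint hνint hmart hf hfμ hfν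
end

section
/- Let μ, ν be probability measures on [0,∞) with ∫ x dμ(x) = ∫ x dν(x) = 1, and let C_μ, C_ν be their call price functions. Then μ ≤_c ν if and only if C_μ(k) ≤ C_ν(k) for all k ≥ 0. -/
open MeasureTheory Filter Topology

/-- The right derivative of a convex function on the real line is a subgradient. -/
lemma ConvexOn.add_rightDeriv_mul_le {f : ℝ → ℝ} (hf : ConvexOn ℝ Set.univ f) (y z : ℝ) :
    f y + derivWithin f (Set.Ioi y) y * (z - y) ≤ f z := by
  have hy : y ∈ interior (Set.univ : Set ℝ) := by simp
  rcases lt_trichotomy y z with h | rfl | h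
  · have h₁ := hf.rightDeriv_le_slope_of_mem_interior hy (Set.mem_univ z) h
    rw [slope_def_field, le_div_iff₀ (sub_pos.2 h)] at h₁
    linarith
  · simp
  · have h₁ := (hf.slope_le_leftDeriv_of_mem_interior (Set.mem_univ z) hy h).trans
      (hf.leftDeriv_le_rightDeriv_of_mem_interior hy)
    rw [slope_def_field, div_le_iff₀ (sub_pos.2 h)] at h₁
    linarith

/-- The line through `(y, f y)` with slope `s y`. -/
def supportLine (f s : ℝ → ℝ) (y x : ℝ) : ℝ := f y + s y * (x - y)

/-- The piecewise linear function which, for an increasing sequence of points `p` and a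
subgradient `s` of `f`, is the maximum of the support lines at `p 0, …, p n`. -/
def supportEnvelope (f s : ℝ → ℝ) (p : ℕ → ℝ) (n : ℕ) (x : ℝ) : ℝ :=
  supportLine f s (p 0) x +
    ∑ i ∈ Finset.range n, max (supportLine f s (p (i + 1)) x - supportLine f s (p i) x) 0

lemma supportEnvelope_succ (f s : ℝ → ℝ) (p : ℕ → ℝ) (n : ℕ) (x : ℝ) :
    supportEnvelope f s p (n + 1) x = supportEnvelope f s p n x +
      max (supportLine f s (p (n + 1)) x - supportLine f s (p n) x) 0 := by
  simp only [supportEnvelope, Finset.sum_range_succ, add_assoc]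

lemma supportLine_le_supportEnvelope (f s : ℝ → ℝ) (p : ℕ → ℝ) {j n : ℕ} (hjn : j ≤ n) (x : ℝ) :
    supportLine f s (p j) x ≤ supportEnvelope f s p n x := by
  induction n, hjn using Nat.le_induction with
  | base =>
    induction j with
    | zero => simp [supportEnvelope]
    | succ j ih =>
      rw [supportEnvelope_succ]
      linarith [le_max_left (supportLine f s (p (j + 1)) x - supportLine f s (p j) x) 0]
  | succ n _ ih =>
    rw [supportEnvelope_succ]
    linarith [le_max_right (supportLine f s (p (n + 1)) x - supportLine f s (p n) x) 0]

lemma monotone_of_supportLine_le {f s : ℝ → ℝ} (hs : ∀ y x, supportLine f s y x ≤ f x) :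
    Monotone s := by
  intro y z hyz
  rcases hyz.eq_or_lt with rfl | h
  · rfl
  · have h₁ := hs y z
    have h₂ := hs z y
    simp only [supportLine] at h₁ h₂
    refine le_of_mul_le_mul_right ?_ (sub_pos.2 h)
    linarith

lemma supportEnvelope_eq_of_le {f s : ℝ → ℝ} (hs : ∀ y x, supportLine f s y x ≤ f x)
    {p : ℕ → ℝ} (hp : Monotone p) {n : ℕ} {x : ℝ} (hx : p n ≤ x) :
    supportEnvelope f s p n x = supportLine f s (p n) x := by
  induction n with
  | zero => simp [supportEnvelope]
  | succ n ih =>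
    have hpn : p n ≤ p (n + 1) := hp n.le_succ
    have h₁ := hs (p n) (p (n + 1))
    have h₂ := mul_nonneg (sub_nonneg.2 (monotone_of_supportLine_le hs hpn)) (sub_nonneg.2 hx)
    rw [supportEnvelope_succ, ih (hpn.trans hx), max_eq_left]
    · ring
    · simp only [supportLine] at h₁ ⊢
      linarith

lemma supportEnvelope_le {f s : ℝ → ℝ} (hs : ∀ y x, supportLine f s y x ≤ f x)
    {p : ℕ → ℝ} (hp : Monotone p) (n : ℕ) (x : ℝ) :
    supportEnvelope f s p n x ≤ f x := by
  induction n with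
  | zero => simpa [supportEnvelope] using hs (p 0) x
  | succ n ih =>
    rw [supportEnvelope_succ]
    rcases le_total (p n) x with hx | hx
    · rw [supportEnvelope_eq_of_le hs hp hx]
      rcases max_cases (supportLine f s (p (n + 1)) x - supportLine f s (p n) x) 0 with h | h
      · linarith [hs (p (n + 1)) x]
      · linarith [hs (p n) x]
    · have hpn : p n ≤ p (n + 1) := hp n.le_succ
      have h₁ := hs (p (n + 1)) (p n)
      have h₂ := mul_nonneg (sub_nonneg.2 (monotone_of_supportLine_le hs hpn)) (sub_nonneg.2 hx)
      rw [max_eq_right, add_zero]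
      · exact ih
      · simp only [supportLine] at h₁ ⊢
        linarith

/-- Along refining and growing grids of `[0, ∞)` the support envelopes converge to `f`. -/
lemma tendsto_supportEnvelope {f s : ℝ → ℝ} (hf : Continuous f)
    (hs : ∀ y x, supportLine f s y x ≤ f x) {x : ℝ} (hx : 0 ≤ x) :
    Tendsto (fun n : ℕ => supportEnvelope f s (fun i : ℕ => (i : ℝ) / ((n + 1 : ℕ) : ℝ))
      ((n + 1) ^ 2) x) atTop (𝓝 (f x)) := by
  have hfloor : Tendsto (fun n : ℕ => (⌊x * ((n + 1 : ℕ) : ℝ)⌋₊ : ℝ) / ((n + 1 : ℕ) : ℝ))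
      atTop (𝓝 x) :=
    (tendsto_nat_floor_mul_div_atTop hx).comp
      (tendsto_natCast_atTop_atTop.comp (tendsto_add_atTop_nat 1))
  have hlower : Tendsto (fun n : ℕ =>
      f ((⌊x * ((n + 1 : ℕ) : ℝ)⌋₊ : ℝ) / ((n + 1 : ℕ) : ℝ)) +
        s 0 * (x - (⌊x * ((n + 1 : ℕ) : ℝ)⌋₊ : ℝ) / ((n + 1 : ℕ) : ℝ))) atTop (𝓝 (f x)) := by
    simpa using ((hf.tendsto x).comp hfloor).add
      ((tendsto_const_nhds (x := x).sub hfloor).const_mul (s 0))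
  refine tendsto_of_tendsto_of_tendsto_of_le_of_le' hlower tendsto_const_nhds ?_ ?_
  · filter_upwards [eventually_ge_atTop ⌈x⌉₊] with n hn
    have hn' : (0 : ℝ) < ((n + 1 : ℕ) : ℝ) := by positivity
    have hxn : x ≤ ((n + 1 : ℕ) : ℝ) :=
      (Nat.ceil_le.1 hn).trans (by exact_mod_cast n.le_succ)
    have hj : ⌊x * ((n + 1 : ℕ) : ℝ)⌋₊ ≤ (n + 1) ^ 2 := by
      apply Nat.floor_le_of_le
      rw [Nat.cast_pow, sq]
      gcongr
    refine le_trans ?_ (supportLine_le_supportEnvelope f s _ hj x)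
    have hle : (⌊x * ((n + 1 : ℕ) : ℝ)⌋₊ : ℝ) / ((n + 1 : ℕ) : ℝ) ≤ x := by
      rw [div_le_iff₀ hn']
      exact Nat.floor_le (by positivity)
    have h0 : (0 : ℝ) ≤ (⌊x * ((n + 1 : ℕ) : ℝ)⌋₊ : ℝ) / ((n + 1 : ℕ) : ℝ) := by positivity
    have hmono := monotone_of_supportLine_le hs h0
    simp only [supportLine]
    gcongr
  · refine Eventually.of_forall fun n => supportEnvelope_le hs ?_ _ x
    intro i j hij
    dsimp only
    gcongr

lemma ae_nonneg_of_measure_Iio_eq_zero {μ : Measure ℝ} (hμ : μ (Set.Iio 0) = 0) :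
    ∀ᵐ x ∂μ, 0 ≤ x := by
  rw [ae_iff]
  simpa [Set.Iio] using hμ

section Integral

variable {μ ν : Measure ℝ} [IsProbabilityMeasure μ] [IsProbabilityMeasure ν]

lemma integral_affine (hμ : Integrable (fun x => x) μ) (a b : ℝ) :
    ∫ x, (a + b * x) ∂μ = a + b * ∫ x, x ∂μ := by
  rw [integral_add (integrable_const _) (hμ.const_mul b), integral_const_mul]
  simp

lemma integrable_max_affine (hμ : Integrable (fun x => x) μ) (a b : ℝ) :
    Integrable (fun x => max (a + b * x) 0) μ :=
  ((integrable_const a).add (hμ.const_mul b)).pos_part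

lemma integral_max_sub_of_nonpos (hsupp : μ (Set.Iio 0) = 0)
    (hμ : Integrable (fun x => x) μ) {k : ℝ} (hk : k ≤ 0) :
    ∫ x, max (x - k) 0 ∂μ = ∫ x, x ∂μ - k := by
  have h : (fun x => max (x - k) 0) =ᵐ[μ] fun x => x - k := by
    filter_upwards [ae_nonneg_of_measure_Iio_eq_zero hsupp] with x hx
    exact max_eq_left (by linarith)
  rw [integral_congr_ae h, integral_sub hμ (integrable_const k)]
  simp

lemma integral_max_affine_le {a b : ℝ} (hb : 0 ≤ b)
    (hcall : ∀ k, ∫ x, max (x - k) 0 ∂μ ≤ ∫ x, max (x - k) 0 ∂ν) :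
    ∫ x, max (a + b * x) 0 ∂μ ≤ ∫ x, max (a + b * x) 0 ∂ν := by
  rcases hb.eq_or_lt with rfl | hb
  · simp
  · have h : ∀ x, max (a + b * x) 0 = b * max (x - -a / b) 0 := fun x => by
      rw [mul_max_of_nonneg _ _ hb.le, mul_zero]
      congr 1
      field_simp
      ring
    simp only [h, integral_const_mul]
    exact mul_le_mul_of_nonneg_left (hcall _) hb.le

lemma supportLine_eq (f s : ℝ → ℝ) (y x : ℝ) :
    supportLine f s y x = (f y - s y * y) + s y * x := by
  simp only [supportLine]
  ring

lemma supportLine_sub_eq (f s : ℝ → ℝ) (y z x : ℝ) :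
    supportLine f s z x - supportLine f s y x =
      (f z - s z * z - (f y - s y * y)) + (s z - s y) * x := by
  simp only [supportLine]
  ring

lemma integrable_supportLine (hμ : Integrable (fun x => x) μ) (f s : ℝ → ℝ) (y : ℝ) :
    Integrable (supportLine f s y) μ := by
  simp only [funext (supportLine_eq f s y)]
  exact (integrable_const _).add (hμ.const_mul _)

lemma integrable_supportEnvelope (hμ : Integrable (fun x => x) μ) (f s : ℝ → ℝ) (p : ℕ → ℝ)
    (n : ℕ) : Integrable (supportEnvelope f s p n) μ := by
  refine (integrable_supportLine hμ f s (p 0)).add (integrable_finsetSum _ fun i _ => ?_)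
  simp only [supportLine_sub_eq]
  exact integrable_max_affine hμ _ _

lemma integral_supportEnvelope_le (hμ : Integrable (fun x => x) μ)
    (hν : Integrable (fun x => x) ν) (hmean : ∫ x, x ∂μ = ∫ x, x ∂ν)
    (hcall : ∀ k, ∫ x, max (x - k) 0 ∂μ ≤ ∫ x, max (x - k) 0 ∂ν)
    {f s : ℝ → ℝ} (hs : Monotone s) {p : ℕ → ℝ} (hp : Monotone p) (n : ℕ) :
    ∫ x, supportEnvelope f s p n x ∂μ ≤ ∫ x, supportEnvelope f s p n x ∂ν := by
  induction n with
  | zero =>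
    simp only [supportEnvelope, Finset.range_zero, Finset.sum_empty, add_zero, supportLine_eq]
    rw [integral_affine hμ, integral_affine hν, hmean]
  | succ n ih =>
    simp only [supportEnvelope_succ, supportLine_sub_eq]
    rw [integral_add (integrable_supportEnvelope hμ f s p n) (integrable_max_affine hμ _ _),
      integral_add (integrable_supportEnvelope hν f s p n) (integrable_max_affine hν _ _)]
    exact add_le_add ih (integral_max_affine_le (sub_nonneg.2 (hs (hp n.le_succ))) hcall)

lemma tendsto_integral_supportEnvelope (hsupp : μ (Set.Iio 0) = 0)
    (hμ : Integrable (fun x => x) μ) {f s : ℝ → ℝ} (hf : Continuous f)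
    (hfμ : Integrable f μ) (hs : ∀ y x, supportLine f s y x ≤ f x) :
    Tendsto (fun n : ℕ => ∫ x, supportEnvelope f s (fun i : ℕ => (i : ℝ) / ((n + 1 : ℕ) : ℝ))
      ((n + 1) ^ 2) x ∂μ) atTop (𝓝 (∫ x, f x ∂μ)) := by
  refine tendsto_integral_of_dominated_convergence (fun x => |supportLine f s 0 x| + |f x|)
    (fun n => (integrable_supportEnvelope hμ f s _ _).aestronglyMeasurable)
    ((integrable_supportLine hμ f s 0).abs.add hfμ.abs) (fun n => ae_of_all _ fun x => ?_) ?_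
  · have hp : Monotone fun i : ℕ => (i : ℝ) / ((n + 1 : ℕ) : ℝ) := by
      intro i j hij
      dsimp only
      gcongr
    have h₁ := supportEnvelope_le hs hp ((n + 1) ^ 2) x
    have h₂ := supportLine_le_supportEnvelope f s (fun i : ℕ => (i : ℝ) / ((n + 1 : ℕ) : ℝ))
      (Nat.zero_le ((n + 1) ^ 2)) x
    simp only [Nat.cast_zero, zero_div] at h₂
    rw [Real.norm_eq_abs, abs_le]
    constructor
    · linarith [neg_abs_le (supportLine f s 0 x), abs_nonneg (f x)]
    · linarith [le_abs_self (f x), abs_nonneg (supportLine f s 0 x)]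
  · filter_upwards [ae_nonneg_of_measure_Iio_eq_zero hsupp] with x hx
    exact tendsto_supportEnvelope hf hs hx

end Integral


/-- for probability measures `μ, ν` on `[0,∞)` with mean `1`, the convex
order `μ ≤_c ν` is equivalent to the pointwise ordering `C_μ(k) ≤ C_ν(k)` of the call
price functions for all `k ≥ 0`. -/
theorem convex_order_iff_call_prices_ordered
    (μ ν : Measure ℝ) [IsProbabilityMeasure μ] [IsProbabilityMeasure ν]
    (hμsupp : μ (Set.Iio 0) = 0) (hνsupp : ν (Set.Iio 0) = 0)
    (hμint : Integrable (fun x => x) μ) (hνint : Integrable (fun x => x) ν)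
    (hμmean : ∫ x, x ∂μ = 1) (hνmean : ∫ x, x ∂ν = 1)
    (Cμ Cν : ℝ → ℝ)
    (hCμ : ∀ k, Cμ k = ∫ x, max (x - k) 0 ∂μ)
    (hCν : ∀ k, Cν k = ∫ x, max (x - k) 0 ∂ν) :
    (∀ f : ℝ → ℝ, ConvexOn ℝ Set.univ f → Integrable f μ → Integrable f ν →
        ∫ x, f x ∂μ ≤ ∫ x, f x ∂ν) ↔
    (∀ k : ℝ, 0 ≤ k → Cμ k ≤ Cν k) := by
  constructor
  · intro h k _
    rw [hCμ, hCν]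
    refine h (fun x => max (x - k) 0) ?_ (hμint.sub (integrable_const k)).pos_part
      (hνint.sub (integrable_const k)).pos_part
    exact ((convexOn_id convex_univ).sub (concaveOn_const k convex_univ)).sup
      (convexOn_const 0 convex_univ)
  · intro h f hf hfμ hfν
    have hcall : ∀ k, ∫ x, max (x - k) 0 ∂μ ≤ ∫ x, max (x - k) 0 ∂ν := fun k => by
      rcases le_total 0 k with hk | hk
      · simpa only [hCμ, hCν] using h k hk
      · rw [integral_max_sub_of_nonpos hμsupp hμint hk,
          integral_max_sub_of_nonpos hνsupp hνint hk, hμmean, hνmean]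
    have hcont : Continuous f := hf.locallyLipschitz.continuous
    have hs : ∀ y x, supportLine f (fun y => derivWithin f (Set.Ioi y) y) y x ≤ f x :=
      hf.add_rightDeriv_mul_le
    refine le_of_tendsto_of_tendsto' (tendsto_integral_supportEnvelope hμsupp hμint hcont hfμ hs)
      (tendsto_integral_supportEnvelope hνsupp hνint hcont hfν hs) fun n => ?_
    refine integral_supportEnvelope_le hμint hνint (hμmean.trans hνmean.symm) hcall
      (monotone_of_supportLine_le hs) ?_ _
    intro i j hij
    dsimp only
    gcongr
end

section
/- Let μ, ν be finitely supported probability measures on [0,∞) and let Q be a finitely supported measure on [0,∞)² with first marginal μ and second marginal ν. Then Q ∈ M(μ,ν) if and only if Q can be written as a finite sum Q = Σ_{j=1}^m Q_j in which each Q_j is either a direct transport or a two-way transport. -/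
noncomputable section

/-- The sum `∫ f dμ = Σ_x μ({x}) f(x)` for a finitely supported measure
given as a finitely supported function `ℝ →₀ ℝ`. -/
def fintSum (p : ℝ →₀ ℝ) (f : ℝ → ℝ) : ℝ := p.sum fun x w => w * f x

/-- `p : ℝ →₀ ℝ` represents a finitely supported probability measure on `[0,∞)`. -/
def IsProbFinsupp (p : ℝ →₀ ℝ) : Prop :=
  (∀ x, 0 ≤ p x) ∧ (p.sum fun _ w => w) = 1 ∧ ∀ x ∈ p.support, (0:ℝ) ≤ x

/-- Convex order `μ ≤_c ν` for finitely supported measures. -/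
def ConvexOrderF (μ ν : ℝ →₀ ℝ) : Prop :=
  ∀ f : ℝ → ℝ, ConvexOn ℝ Set.univ f → fintSum μ f ≤ fintSum ν f

/-- First marginal of a finitely supported measure on the plane. -/
def fstMarg (Q : ℝ × ℝ →₀ ℝ) (x : ℝ) : ℝ := Q.sum fun p w => if p.1 = x then w else 0

/-- Second marginal of a finitely supported measure on the plane. -/
def sndMarg (Q : ℝ × ℝ →₀ ℝ) (y : ℝ) : ℝ := Q.sum fun p w => if p.2 = y then w else 0

/-- `Q ∈ M(μ,ν)`: `Q` is a finitely supported probability measure on `[0,∞)²` with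
marginals `μ` and `ν` satisfying the martingale condition. -/
def MemMart (μ ν : ℝ →₀ ℝ) (Q : ℝ × ℝ →₀ ℝ) : Prop :=
  (∀ p, 0 ≤ Q p) ∧ (Q.sum fun _ w => w) = 1 ∧
  (∀ p ∈ Q.support, (0:ℝ) ≤ p.1 ∧ (0:ℝ) ≤ p.2) ∧
  (∀ x, fstMarg Q x = μ x) ∧ (∀ y, sndMarg Q y = ν y) ∧
  (∀ x ∈ μ.support, (Q.sum fun p w => if p.1 = x then w * p.2 else 0) = x * μ x)


/-- A direct transport `ω·δ_{(x,x)}` with `ω ∈ (0,1)` and `x ≥ 0`. -/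
def IsDirectTransport (Q : ℝ × ℝ →₀ ℝ) : Prop :=
  ∃ ω x : ℝ, ω ∈ Set.Ioo (0:ℝ) 1 ∧ 0 ≤ x ∧ Q = Finsupp.single (x, x) ω

/-- A two-way transport `ϑ₁·δ_{(x,y₁)} + ϑ₂·δ_{(x,y₂)}` with `ϑ₁, ϑ₂ ∈ (0,1)`,
`y₂ < x < y₁`, `y₂ ≥ 0` and `(ϑ₁+ϑ₂)·x = ϑ₁·y₁ + ϑ₂·y₂`. -/
def IsTwoWayTransport (Q : ℝ × ℝ →₀ ℝ) : Prop :=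
  ∃ ϑ₁ ϑ₂ x y₁ y₂ : ℝ, ϑ₁ ∈ Set.Ioo (0:ℝ) 1 ∧ ϑ₂ ∈ Set.Ioo (0:ℝ) 1 ∧
    0 ≤ y₂ ∧ y₂ < x ∧ x < y₁ ∧ (ϑ₁ + ϑ₂) * x = ϑ₁ * y₁ + ϑ₂ * y₂ ∧
    Q = Finsupp.single (x, y₁) ϑ₁ + Finsupp.single (x, y₂) ϑ₂

/-- The signed martingale defect `Σ_y Q({(x,y)}) (y - x)` of `Q` at `x`, as a linear map. -/
def martingaleDefect (x : ℝ) : (ℝ × ℝ →₀ ℝ) →ₗ[ℝ] ℝ :=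
  Finsupp.linearCombination ℝ fun p => if p.1 = x then p.2 - x else 0

/-- The total mass of `Q`, as a linear map. -/
def totalMass : (ℝ × ℝ →₀ ℝ) →ₗ[ℝ] ℝ :=
  Finsupp.linearCombination ℝ fun _ => (1 : ℝ)

lemma totalMass_eq_sum (Q : ℝ × ℝ →₀ ℝ) : totalMass Q = Q.sum fun _ w => w := by
  simp [totalMass, Finsupp.linearCombination_apply]

lemma totalMass_nonneg {Q : ℝ × ℝ →₀ ℝ} (hQ : ∀ p, 0 ≤ Q p) : 0 ≤ totalMass Q := by
  rw [totalMass_eq_sum]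
  exact Finset.sum_nonneg fun p _ => hQ p

lemma totalMass_eq_of_fstMarg {μ : ℝ →₀ ℝ} {Q : ℝ × ℝ →₀ ℝ} (h : ∀ x, fstMarg Q x = μ x) :
    totalMass Q = μ.sum fun _ w => w := by
  have hμ : Q.mapDomain Prod.fst = μ := by
    ext x
    rw [← h x, fstMarg, Finsupp.mapDomain, Finsupp.sum_apply]
    simp only [Finsupp.single_apply]
  rw [totalMass_eq_sum, ← hμ, Finsupp.sum_mapDomain_index (fun _ => rfl) (fun _ _ _ => rfl)]

lemma sum_fst_eq_mul_snd (Q : ℝ × ℝ →₀ ℝ) (x : ℝ) :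
    (Q.sum fun p w => if p.1 = x then w * p.2 else 0) =
      martingaleDefect x Q + x * fstMarg Q x := by
  simp only [martingaleDefect, Finsupp.linearCombination_apply, fstMarg, Finsupp.sum,
    Finset.mul_sum, ← Finset.sum_add_distrib]
  refine Finset.sum_congr rfl fun p _ => ?_
  split_ifs <;> simp <;> ring

lemma martingaleDefect_eq_zero_of_fstMarg_eq_zero {Q : ℝ × ℝ →₀ ℝ} (hQ : ∀ p, 0 ≤ Q p) {x : ℝ}
    (h : fstMarg Q x = 0) : martingaleDefect x Q = 0 := by
  rw [fstMarg, Finsupp.sum, Finset.sum_eq_zero_iff_of_nonneg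
    (fun p _ => by split_ifs <;> simp [hQ p])] at h
  rw [martingaleDefect, Finsupp.linearCombination_apply]
  refine Finset.sum_eq_zero fun p hp => ?_
  have := h p hp
  split_ifs at this ⊢ <;> simp_all

lemma IsDirectTransport.martingaleDefect_eq_zero {Q : ℝ × ℝ →₀ ℝ} (hQ : IsDirectTransport Q)
    (x : ℝ) : martingaleDefect x Q = 0 := by
  obtain ⟨ω, z, -, -, rfl⟩ := hQ
  simp only [martingaleDefect, Finsupp.linearCombination_single]
  split_ifs with h <;> simp_all

lemma IsTwoWayTransport.martingaleDefect_eq_zero {Q : ℝ × ℝ →₀ ℝ} (hQ : IsTwoWayTransport Q)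
    (x : ℝ) : martingaleDefect x Q = 0 := by
  obtain ⟨a, b, z, y₁, y₂, -, -, -, -, -, h, rfl⟩ := hQ
  simp only [martingaleDefect, map_add, Finsupp.linearCombination_single, smul_eq_mul]
  split_ifs with hz
  · subst hz
    linarith
  · simp

/-- The additive submonoid of all finite sums of direct and two-way transports. -/
def transportSums : AddSubmonoid (ℝ × ℝ →₀ ℝ) :=
  AddSubmonoid.closure {Q | IsDirectTransport Q ∨ IsTwoWayTransport Q}

lemma exists_fin_sum_of_mem_transportSums {Q : ℝ × ℝ →₀ ℝ} (hQ : Q ∈ transportSums) :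
    ∃ (m : ℕ) (Qs : Fin m → (ℝ × ℝ →₀ ℝ)),
      (∀ j, IsDirectTransport (Qs j) ∨ IsTwoWayTransport (Qs j)) ∧ Q = ∑ j, Qs j := by
  obtain ⟨l, hl, rfl⟩ := AddSubmonoid.exists_list_of_mem_closure hQ
  exact ⟨l.length, l.get, fun j => hl _ (l.get_mem j), by simp⟩

lemma single_diag_mem_transportSums {x w : ℝ} (hx : 0 ≤ x) (hw : 0 < w) (hw1 : w ≤ 1) :
    Finsupp.single (x, x) w ∈ transportSums := by
  have h : Finsupp.single (x, x) (w / 2) ∈ transportSums :=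
    AddSubmonoid.subset_closure (Or.inl ⟨w / 2, x, ⟨by linarith, by linarith⟩, hx, rfl⟩)
  rw [← add_halves w, Finsupp.single_add]
  exact add_mem h h

/-- From a nonnegative `Q` of vanishing defect one can split off a nonzero sum of transports
below `Q` that exhausts one of the atoms of `Q`. -/
lemma exists_transport_le {Q : ℝ × ℝ →₀ ℝ} (hQ : ∀ p, 0 ≤ Q p)
    (hs : ∀ p ∈ Q.support, (0 : ℝ) ≤ p.1 ∧ (0 : ℝ) ≤ p.2) (hm : totalMass Q ≤ 1)
    (hd : ∀ x, martingaleDefect x Q = 0) (h0 : Q ≠ 0) :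
    ∃ T ∈ transportSums, (∀ p, 0 ≤ T p) ∧ (∀ p, T p ≤ Q p) ∧
      (∀ x, martingaleDefect x T = 0) ∧ ∃ p ∈ Q.support, T p = Q p := by
  have mass_le : ∀ {T : ℝ × ℝ →₀ ℝ}, (∀ p, T p ≤ Q p) → totalMass T ≤ 1 := fun {T} hT => by
    have := totalMass_nonneg (Q := Q - T) fun p => by simpa using hT p
    rw [map_sub] at this
    linarith
  have pos : ∀ {p}, p ∈ Q.support → 0 < Q p := fun {p} hp =>
    (hQ p).lt_of_ne' (Finsupp.mem_support_iff.1 hp)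
  obtain ⟨⟨x, y⟩, hp⟩ := Finsupp.support_nonempty_iff.2 h0
  rcases eq_or_ne y x with rfl | hyx
  · have hle : ∀ p, Finsupp.single (y, y) (Q (y, y)) p ≤ Q p := fun p => by
      rw [Finsupp.single_apply]
      split_ifs with h
      · rw [h]
      · exact hQ p
    have h1 := mass_le hle
    simp only [totalMass, Finsupp.linearCombination_single, smul_eq_mul, mul_one] at h1
    refine ⟨_, single_diag_mem_transportSums (hs _ hp).1 (pos hp) h1, fun p => ?_, hle,
      fun z => ?_, _, hp, by simp⟩
    · rw [Finsupp.single_apply]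
      split_ifs <;> simp [hQ]
    · simp only [martingaleDefect, Finsupp.linearCombination_single]
      split_ifs with h <;> simp_all
  · let f : ℝ × ℝ → ℝ := fun p => Q p * if p.1 = x then p.2 - x else 0
    have hf : ∑ p ∈ Q.support, f p = 0 := by
      rw [← hd x, martingaleDefect, Finsupp.linearCombination_apply]
      rfl
    have hne : f (x, y) ≠ 0 := by
      simpa [f, sub_ne_zero, hyx] using (pos hp).ne'
    obtain ⟨⟨x₁, y₁⟩, hp₁, h₁⟩ := Finset.exists_pos_of_sum_zero_of_exists_nonzero f hf ⟨_, hp, hne⟩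
    obtain ⟨⟨x₂, y₂⟩, hp₂, h₂⟩ := Finset.exists_pos_of_sum_zero_of_exists_nonzero (-f)
      (by simpa using hf) ⟨_, hp, by simpa using hne⟩
    have hx₁ : x₁ = x := by
      by_contra h
      simp [f, h] at h₁
    have hx₂ : x₂ = x := by
      by_contra h
      simp [f, h] at h₂
    subst hx₁ hx₂
    have hy₁ : 0 < y₁ - x₂ := by
      simpa [f, pos hp₁] using h₁
    have hy₂ : 0 < x₂ - y₂ := by
      simp only [f, Pi.neg_apply, if_true] at h₂
      have := pos hp₂
      by_contra! h
      nlinarith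
    -- any balanced pair of weights below those of `Q` gives a two-way transport below `Q`
    have key : ∀ a b : ℝ, 0 < a → 0 < b → a ≤ Q (x₂, y₁) → b ≤ Q (x₂, y₂) →
        a * (y₁ - x₂) = b * (x₂ - y₂) → (a = Q (x₂, y₁) ∨ b = Q (x₂, y₂)) →
        ∃ T ∈ transportSums, (∀ p, 0 ≤ T p) ∧ (∀ p, T p ≤ Q p) ∧
          (∀ x, martingaleDefect x T = 0) ∧ ∃ p ∈ Q.support, T p = Q p := by
      intro a b ha hb haQ hbQ hab hor
      have hy : y₁ ≠ y₂ := by linarith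
      set T := Finsupp.single (x₂, y₁) a + Finsupp.single (x₂, y₂) b with hT
      have hT₁ : T (x₂, y₁) = a := by simp [hT, hy.symm]
      have hT₂ : T (x₂, y₂) = b := by simp [hT, hy]
      have hT₀ : ∀ p, p ≠ (x₂, y₁) → p ≠ (x₂, y₂) → T p = 0 := fun p h h' => by
        simp [hT, h.symm, h'.symm]
      have hle : ∀ p, T p ≤ Q p := fun p => by
        by_cases h : p = (x₂, y₁)
        · rw [h, hT₁]
          exact haQ
        by_cases h' : p = (x₂, y₂)
        · rw [h', hT₂]
          exact hbQ
        rw [hT₀ p h h']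
        exact hQ p
      have h1 := mass_le hle
      simp only [hT, totalMass, map_add, Finsupp.linearCombination_single, smul_eq_mul,
        mul_one] at h1
      have htw : IsTwoWayTransport T :=
        ⟨a, b, x₂, y₁, y₂, ⟨ha, by linarith⟩, ⟨hb, by linarith⟩, (hs _ hp₂).2, by linarith,
          by linarith, by linarith, hT⟩
      refine ⟨T, AddSubmonoid.subset_closure (Or.inr htw), fun p => ?_, hle,
        htw.martingaleDefect_eq_zero, ?_⟩
      · simp only [hT, Finsupp.add_apply, Finsupp.single_apply]
        split_ifs <;> positivity
      · rcases hor with h | h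
        · exact ⟨_, hp₁, hT₁.trans h⟩
        · exact ⟨_, hp₂, hT₂.trans h⟩
    rcases le_total (Q (x₂, y₁) * (y₁ - x₂)) (Q (x₂, y₂) * (x₂ - y₂)) with h | h
    · exact key (Q (x₂, y₁)) (Q (x₂, y₁) * (y₁ - x₂) / (x₂ - y₂)) (pos hp₁)
        (div_pos (mul_pos (pos hp₁) hy₁) hy₂) le_rfl ((div_le_iff₀ hy₂).2 h)
        (div_mul_cancel₀ _ hy₂.ne').symm (Or.inl rfl)
    · exact key (Q (x₂, y₂) * (x₂ - y₂) / (y₁ - x₂)) (Q (x₂, y₂))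
        (div_pos (mul_pos (pos hp₂) hy₂) hy₁) (pos hp₂) ((div_le_iff₀ hy₁).2 h) le_rfl
        (div_mul_cancel₀ _ hy₁.ne') (Or.inr rfl)

theorem mem_transportSums_of_martingaleDefect_eq_zero {Q : ℝ × ℝ →₀ ℝ} (hQ : ∀ p, 0 ≤ Q p)
    (hs : ∀ p ∈ Q.support, (0 : ℝ) ≤ p.1 ∧ (0 : ℝ) ≤ p.2) (hm : totalMass Q ≤ 1)
    (hd : ∀ x, martingaleDefect x Q = 0) : Q ∈ transportSums := by
  induction hn : Q.support.card using Nat.strong_induction_on generalizing Q with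
  | _ n ih =>
    subst hn
    rcases eq_or_ne Q 0 with rfl | h0
    · exact zero_mem _
    obtain ⟨T, hT, hTpos, hTle, hTd, p, hp, hpT⟩ := exists_transport_le hQ hs hm hd h0
    have hsub : (Q - T).support ⊆ Q.support := fun q hq => by
      rw [Finsupp.mem_support_iff] at hq ⊢
      intro h
      refine hq ?_
      rw [Finsupp.sub_apply, h, le_antisymm (h ▸ hTle q) (hTpos q), sub_zero]
    have hlt : (Q - T).support.card < Q.support.card :=
      Finset.card_lt_card ((Finset.ssubset_iff_of_subset hsub).2 ⟨p, hp, by simp [hpT]⟩)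
    have hmem := ih _ hlt (Q := Q - T) (fun q => by simpa using hTle q)
      (fun q hq => hs q (hsub hq))
      (by rw [map_sub]; linarith [totalMass_nonneg hTpos])
      (fun x => by rw [map_sub, hd, hTd, sub_zero]) rfl
    simpa using add_mem hmem hT

/-- a finitely supported measure `Q` on `[0,∞)²` with marginals `μ` and
`ν` belongs to `M(μ,ν)` if and only if it is a finite sum of direct and two-way
transports. -/
theorem martingale_transport_iff_sum_of_direct_and_two_way
    (μ ν : ℝ →₀ ℝ) (hμ : IsProbFinsupp μ) (hν : IsProbFinsupp ν)
    (Q : ℝ × ℝ →₀ ℝ) (hQpos : ∀ p, 0 ≤ Q p)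
    (hQsupp : ∀ p ∈ Q.support, (0:ℝ) ≤ p.1 ∧ (0:ℝ) ≤ p.2)
    (hQfst : ∀ x, fstMarg Q x = μ x) (hQsnd : ∀ y, sndMarg Q y = ν y) :
    MemMart μ ν Q ↔
    ∃ (m : ℕ) (Qs : Fin m → (ℝ × ℝ →₀ ℝ)),
      (∀ j, IsDirectTransport (Qs j) ∨ IsTwoWayTransport (Qs j)) ∧
      Q = ∑ j, Qs j := by
  have hmass : totalMass Q = 1 := (totalMass_eq_of_fstMarg hQfst).trans hμ.2.1
  constructor
  · rintro ⟨-, -, -, -, -, hmart⟩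
    refine exists_fin_sum_of_mem_transportSums
      (mem_transportSums_of_martingaleDefect_eq_zero hQpos hQsupp hmass.le fun x => ?_)
    by_cases hx : x ∈ μ.support
    · have h := hmart x hx
      rw [sum_fst_eq_mul_snd, hQfst] at h
      linarith
    · exact martingaleDefect_eq_zero_of_fstMarg_eq_zero hQpos
        ((hQfst x).trans (Finsupp.notMem_support_iff.1 hx))
  · rintro ⟨m, Qs, hQs, hsum⟩
    refine ⟨hQpos, totalMass_eq_sum Q ▸ hmass, hQsupp, hQfst, hQsnd, fun x _ => ?_⟩
    have hd : martingaleDefect x Q = 0 := by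
      rw [hsum, map_sum]
      exact Finset.sum_eq_zero fun j _ =>
        (hQs j).elim (fun h => h.martingaleDefect_eq_zero x)
          (fun h => h.martingaleDefect_eq_zero x)
    rw [sum_fst_eq_mul_snd, hd, hQfst, zero_add]

end
end

section
/- Fix strikes 0 = k_0 < ... < k_n with prices 1 = c_0 ≥ ... ≥ c_n = 0, write S₁ = {k_0,...,k_n}, and let μ be a finitely supported probability measure in P₁. Suppose μ has mass κ = μ({x̃}) > 0 at a point x̃ ∉ S₁, and set x₂ = max { x ∈ S₁ ∪ supp(μ) : x < x̃ } and x₁ = min { x ∈ S₁ ∪ supp(μ) : x > x̃ } (both assumed to exist). Then the measure μ̃ = μ − κ·δ_{x̃} + κ·((x₁−x̃)/(x₁−x₂))·δ_{x₂} + κ·((x̃−x₂)/(x₁−x₂))·δ_{x₁} is a probability measure belonging to P₁ and satisfies μ ≤_c μ̃. -/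
noncomputable section

/-- `μ` is a finitely supported probability measure on `[0,∞)` with mean `1` consistent
with the observed call prices `c j` at strikes `k j`, `j = 0, …, n`. -/
def MemConsistent (n : ℕ) (k c : ℕ → ℝ) (μ : ℝ →₀ ℝ) : Prop :=
  IsProbFinsupp μ ∧ fintSum μ (fun x => x) = 1 ∧
  ∀ j ≤ n, fintSum μ (fun x => max (x - k j) 0) = c j

theorem fintSum_eq_linearCombination (p : ℝ →₀ ℝ) (f : ℝ → ℝ) :
    fintSum p f = Finsupp.linearCombination ℝ f p := by
  simp [fintSum, Finsupp.linearCombination_apply]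

theorem sum_weights_eq_fintSum_one (p : ℝ →₀ ℝ) :
    (p.sum fun _ w => w) = fintSum p fun _ => 1 := by
  simp [fintSum]

/-- Replacing mass `κ` at `y` by masses `α` at `u` and `β` at `v` changes an integral by the
corresponding point evaluations. -/
theorem fintSum_shift (p : ℝ →₀ ℝ) (y u v κ α β : ℝ) (f : ℝ → ℝ) :
    fintSum (p - Finsupp.single y κ + Finsupp.single u α + Finsupp.single v β) f
      = fintSum p f - κ * f y + α * f u + β * f v := by
  simp [fintSum_eq_linearCombination, Finsupp.linearCombination_single]

/-- if `μ ∈ P₁` has mass `κ > 0` at a point `xt` which is not a strike,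
and `x₂`, `x₁` are the closest points of `S₁ ∪ supp(μ)` below and above `xt`, then
shifting the mass `κ` from `xt` to `x₂` and `x₁` in the martingale way produces a
measure `μ̃ ∈ P₁` with `μ ≤_c μ̃`. -/
theorem two_way_mass_shift_stays_consistent
    (n : ℕ) (hn : 0 < n) (k c : ℕ → ℝ)
    (hk0 : k 0 = 0) (hkmono : ∀ j, j < n → k j < k (j + 1))
    (hc0 : c 0 = 1) (hcn : c n = 0) (hcdec : ∀ j, j < n → c (j + 1) ≤ c j)
    (μ : ℝ →₀ ℝ) (hμ : MemConsistent n k c μ)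
    (xt : ℝ) (hxt : ∀ j ≤ n, k j ≠ xt)
    (κ : ℝ) (hκ : κ = μ xt) (hκpos : 0 < κ)
    (S : Set ℝ) (hS : S = {x : ℝ | (∃ j ≤ n, x = k j) ∨ x ∈ μ.support})
    (x₂ : ℝ) (hx₂ : IsGreatest {x ∈ S | x < xt} x₂)
    (x₁ : ℝ) (hx₁ : IsLeast {x ∈ S | xt < x} x₁)
    (μtilde : ℝ →₀ ℝ)
    (hμtilde : μtilde = μ - Finsupp.single xt κ
        + Finsupp.single x₂ (κ * ((x₁ - xt) / (x₁ - x₂)))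
        + Finsupp.single x₁ (κ * ((xt - x₂) / (x₁ - x₂)))) :
    MemConsistent n k c μtilde ∧ ConvexOrderF μ μtilde := by
  obtain ⟨⟨hnonneg, hmass, hsupp⟩, hmean, hcall⟩ := hμ
  subst hS
  obtain ⟨⟨-, hx₂t⟩, hmax⟩ := hx₂
  obtain ⟨⟨-, hx₁t⟩, hmin⟩ := hx₁
  have hd : 0 < x₁ - x₂ := by linarith
  set a := (x₁ - xt) / (x₁ - x₂) with ha
  set b := (xt - x₂) / (x₁ - x₂) with hb
  have ha0 : 0 ≤ a := div_nonneg (by linarith) hd.le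
  have hb0 : 0 ≤ b := div_nonneg (by linarith) hd.le
  have hab : a + b = 1 := by rw [ha, hb]; field_simp; ring
  have habx : a * x₂ + b * x₁ = xt := by rw [ha, hb]; field_simp; ring
  have hshift (f : ℝ → ℝ) :
      fintSum μtilde f = fintSum μ f + κ * (a * f x₂ + b * f x₁ - f xt) := by
    rw [hμtilde, fintSum_shift]; ring
  have hxt0 : 0 < xt := by
    refine lt_of_le_of_ne (hsupp xt ?_) (hk0 ▸ hxt 0 (Nat.zero_le n))
    rw [Finsupp.mem_support_iff, ← hκ]
    exact hκpos.ne'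
  have hx₂0 : 0 ≤ x₂ := hmax ⟨Or.inl ⟨0, Nat.zero_le n, hk0.symm⟩, hxt0⟩
  refine ⟨⟨⟨fun x => ?_, ?_, fun x hx => ?_⟩, ?_, fun j hj => ?_⟩, fun f hf => ?_⟩
  · have h₀ : 0 ≤ (μ - Finsupp.single xt κ) x := by
      rcases eq_or_ne x xt with rfl | hne
      · simp [hκ]
      · simpa [Finsupp.single_eq_of_ne hne] using hnonneg x
    have h₂ : 0 ≤ Finsupp.single x₂ (κ * a) :=
      Finsupp.single_nonneg.2 (mul_nonneg hκpos.le ha0)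
    have h₁ : 0 ≤ Finsupp.single x₁ (κ * b) :=
      Finsupp.single_nonneg.2 (mul_nonneg hκpos.le hb0)
    rw [hμtilde]
    exact add_nonneg (add_nonneg h₀ (h₂ x)) (h₁ x)
  · rw [sum_weights_eq_fintSum_one] at hmass ⊢
    rw [hshift, hmass, mul_one, mul_one, hab]
    ring
  · by_contra! hneg
    have hμx : μ x = 0 := by
      by_contra h
      exact hneg.not_ge (hsupp x (Finsupp.mem_support_iff.2 h))
    refine Finsupp.mem_support_iff.1 hx ?_
    rw [hμtilde]
    simp [hμx, Finsupp.single_eq_of_ne (show x ≠ xt by linarith),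
      Finsupp.single_eq_of_ne (show x ≠ x₂ by linarith),
      Finsupp.single_eq_of_ne (show x ≠ x₁ by linarith)]
  · rw [hshift, hmean, habx]
    ring
  · rw [hshift, hcall j hj]
    rcases lt_or_gt_of_ne (hxt j hj) with h | h
    · have hle : k j ≤ x₂ := hmax ⟨Or.inl ⟨j, hj, rfl⟩, h⟩
      rw [max_eq_left (by linarith), max_eq_left (by linarith), max_eq_left (by linarith)]
      linear_combination κ * habx - κ * k j * hab
    · have hle : x₁ ≤ k j := hmin ⟨Or.inl ⟨j, hj, rfl⟩, h⟩
      rw [max_eq_right (by linarith), max_eq_right (by linarith), max_eq_right (by linarith)]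
      ring
  · have hconv : f xt ≤ a * f x₂ + b * f x₁ := by
      simpa [habx] using hf.2 (Set.mem_univ x₂) (Set.mem_univ x₁) ha0 hb0 hab
    rw [hshift]
    exact le_add_of_nonneg_right (mul_nonneg hκpos.le (sub_nonneg.2 hconv))

end
end

section
/- Let c : ℝ² → ℝ be directionally convex. Let y₂ ≤ x₂ < x̃ < x₁ ≤ y₁ with y₂ < y₁, let κ > 0, α ∈ [0,κ], θ ∈ [0,κ] satisfy α·y₁ + (κ−α)·y₂ = κ·x̃ and θ·x₁ + (κ−θ)·x₂ = κ·x̃, and set ϑ₁ = θ·(x₁−y₂)/(y₁−y₂) and ϑ₂ = α − ϑ₁. Then c(x̃,y₁)·α + c(x̃,y₂)·(κ−α) ≤ c(x₁,y₁)·ϑ₁ + c(x₁,y₂)·(θ−ϑ₁) + c(x₂,y₁)·ϑ₂ + c(x₂,y₂)·(κ−θ−ϑ₂). -/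
/-- Supermodularity of `c : ℝ² → ℝ`. -/
def Supermodular (c : ℝ → ℝ → ℝ) : Prop :=
  ∀ x₁ y₁ x₂ y₂ : ℝ,
    c x₁ y₁ + c x₂ y₂ ≤ c (min x₁ x₂) (min y₁ y₂) + c (max x₁ x₂) (max y₁ y₂)

/-- Directional convexity of `c : ℝ² → ℝ`: convexity in each variable separately
together with supermodularity. -/
def DirectionallyConvex (c : ℝ → ℝ → ℝ) : Prop :=
  (∀ y : ℝ, ConvexOn ℝ Set.univ (fun t => c t y)) ∧
  (∀ x : ℝ, ConvexOn ℝ Set.univ (fun t => c x t)) ∧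
  Supermodular c

/-- Jensen's inequality for two points with weights of total mass `κ`. -/
theorem ConvexOn.mul_le_of_two_points {f : ℝ → ℝ} (hf : ConvexOn ℝ Set.univ f)
    {κ θ x x₁ x₂ : ℝ} (hκ : 0 < κ) (hθ : θ ∈ Set.Icc 0 κ)
    (hx : θ * x₁ + (κ - θ) * x₂ = κ * x) :
    κ * f x ≤ θ * f x₁ + (κ - θ) * f x₂ := by
  have h := hf.2 (Set.mem_univ x₁) (Set.mem_univ x₂) (div_nonneg hθ.1 hκ.le)
    (div_nonneg (sub_nonneg.2 hθ.2) hκ.le) (by field_simp; ring)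
  have hmean : θ / κ * x₁ + (κ - θ) / κ * x₂ = x := by
    field_simp
    linarith
  simp only [smul_eq_mul, hmean] at h
  calc κ * f x ≤ κ * (θ / κ * f x₁ + (κ - θ) / κ * f x₂) := by gcongr
    _ = θ * f x₁ + (κ - θ) * f x₂ := by field_simp

/-- A supermodular function has increasing differences. -/
theorem Supermodular.add_le_add {c : ℝ → ℝ → ℝ} (hc : Supermodular c)
    {x x' y y' : ℝ} (hx : x ≤ x') (hy : y ≤ y') :
    c x y' + c x' y ≤ c x y + c x' y' := by
  simpa [hx, hy] using hc x y' x' y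

/-- the key inequality in the proof of the main theorem: splitting the
two-way transport from `x̃` to `{y₁, y₂}` through the two-way transport from `x̃` to
`{x₁, x₂}` does not decrease the expected payoff of a directionally convex `c`. -/
theorem directionally_convex_transport_split_inequality
    (c : ℝ → ℝ → ℝ) (hc : DirectionallyConvex c)
    (y₂ x₂ xt x₁ y₁ : ℝ)
    (h1 : y₂ ≤ x₂) (h2 : x₂ < xt) (h3 : xt < x₁) (h4 : x₁ ≤ y₁) (h5 : y₂ < y₁)
    (κ α θ : ℝ) (hκ : 0 < κ) (hα : α ∈ Set.Icc 0 κ) (hθ : θ ∈ Set.Icc 0 κ)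
    (hmart1 : α * y₁ + (κ - α) * y₂ = κ * xt)
    (hmart2 : θ * x₁ + (κ - θ) * x₂ = κ * xt)
    (ϑ₁ ϑ₂ : ℝ)
    (hϑ₁ : ϑ₁ = θ * (x₁ - y₂) / (y₁ - y₂)) (hϑ₂ : ϑ₂ = α - ϑ₁) :
    c xt y₁ * α + c xt y₂ * (κ - α) ≤
      c x₁ y₁ * ϑ₁ + c x₁ y₂ * (θ - ϑ₁) + c x₂ y₁ * ϑ₂ + c x₂ y₂ * (κ - θ - ϑ₂) := by
  obtain ⟨hconv, -, hsup⟩ := hc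
  have hy : 0 < y₁ - y₂ := sub_pos.2 h5
  set q₁ := (x₁ - y₂) / (y₁ - y₂) with hq₁
  set q₂ := (x₂ - y₂) / (y₁ - y₂) with hq₂
  have hq₂_nonneg : 0 ≤ q₂ := div_nonneg (by linarith) hy.le
  have hq₂_le : q₂ ≤ 1 := (div_le_one hy).2 (by linarith)
  have hq : q₂ ≤ q₁ := by
    rw [hq₁, hq₂]
    gcongr
    linarith
  have hϑ : ϑ₁ = θ * q₁ := by rw [hϑ₁, hq₁, mul_div_assoc]
  have hα_eq : α = θ * q₁ + (κ - θ) * q₂ := by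
    rw [hq₁, hq₂]
    field_simp
    linarith
  have hupper := mul_le_mul_of_nonneg_left
    ((hconv y₁).mul_le_of_two_points hκ hθ hmart2) hq₂_nonneg
  have hlower := mul_le_mul_of_nonneg_left
    ((hconv y₂).mul_le_of_two_points hκ hθ hmart2) (sub_nonneg.2 hq₂_le)
  have hcross := mul_le_mul_of_nonneg_left (hsup.add_le_add h3.le h5.le)
    (mul_nonneg hθ.1 (sub_nonneg.2 hq))
  rw [hϑ₂, hϑ, hα_eq]
  linarith
end

section
/- Let μ = (1/4)·δ_1 + (1/2)·δ_{7/3} + (1/4)·δ_3 and ν = (1/4)·δ_0 + (1/2)·δ_{7/3} + (1/4)·δ_4. Then μ ≤_c ν and sup_{Q ∈ M(μ,ν)} Σ_{(x,y)} Q({(x,y)})·x·y² = 913/54. -/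
noncomputable section

/-- Expectation `E_Q[c(X,Y)]` for a finitely supported measure on the plane. -/
def expPay (Q : ℝ × ℝ →₀ ℝ) (c : ℝ → ℝ → ℝ) : ℝ := Q.sum fun p w => w * c p.1 p.2

theorem fstMarg_add (P Q : ℝ × ℝ →₀ ℝ) (x : ℝ) :
    fstMarg (P + Q) x = fstMarg P x + fstMarg Q x :=
  Finsupp.sum_add_index' (by simp) fun p a b => by split_ifs <;> simp

theorem sndMarg_add (P Q : ℝ × ℝ →₀ ℝ) (y : ℝ) :
    sndMarg (P + Q) y = sndMarg P y + sndMarg Q y :=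
  Finsupp.sum_add_index' (by simp) fun p a b => by split_ifs <;> simp

theorem fstMarg_single (p : ℝ × ℝ) (w x : ℝ) :
    fstMarg (Finsupp.single p w) x = Finsupp.single p.1 w x := by
  simp [fstMarg, Finsupp.sum_single_index, Finsupp.single_apply]

theorem sndMarg_single (p : ℝ × ℝ) (w y : ℝ) :
    sndMarg (Finsupp.single p w) y = Finsupp.single p.2 w y := by
  simp [sndMarg, Finsupp.sum_single_index, Finsupp.single_apply]

theorem le_fstMarg {Q : ℝ × ℝ →₀ ℝ} (hQ : ∀ p, 0 ≤ Q p) (p : ℝ × ℝ) : Q p ≤ fstMarg Q p.1 := by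
  by_cases hp : p ∈ Q.support
  · have h := Finset.single_le_sum (f := fun q => if q.1 = p.1 then Q q else 0)
      (fun q _ => by split_ifs <;> simp [hQ]) hp
    simpa [fstMarg, Finsupp.sum] using h
  · rw [Finsupp.notMem_support_iff.mp hp]
    exact Finset.sum_nonneg fun q _ => by dsimp only; split_ifs <;> simp [hQ]

theorem le_sndMarg {Q : ℝ × ℝ →₀ ℝ} (hQ : ∀ p, 0 ≤ Q p) (p : ℝ × ℝ) : Q p ≤ sndMarg Q p.2 := by
  by_cases hp : p ∈ Q.support
  · have h := Finset.single_le_sum (f := fun q => if q.2 = p.2 then Q q else 0)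
      (fun q _ => by split_ifs <;> simp [hQ]) hp
    simpa [sndMarg, Finsupp.sum] using h
  · rw [Finsupp.notMem_support_iff.mp hp]
    exact Finset.sum_nonneg fun q _ => by dsimp only; split_ifs <;> simp [hQ]

/-- A martingale transport is carried by the product of the supports of its marginals. -/
theorem MemMart.support_subset {μ ν : ℝ →₀ ℝ} {Q : ℝ × ℝ →₀ ℝ} (h : MemMart μ ν Q) :
    Q.support ⊆ μ.support ×ˢ ν.support := by
  obtain ⟨hQ, -, -, h₁, h₂, -⟩ := h
  intro p hp
  have hpos : 0 < Q p := (hQ p).lt_of_ne' (Finsupp.mem_support_iff.mp hp)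
  rw [Finset.mem_product, Finsupp.mem_support_iff, Finsupp.mem_support_iff, ← h₁, ← h₂]
  exact ⟨(hpos.trans_le (le_fstMarg hQ p)).ne', (hpos.trans_le (le_sndMarg hQ p)).ne'⟩

/-- The support of a combination of three Dirac masses consists of at most three points. -/
theorem support_three_singles_subset (a b c u v w : ℝ) :
    (Finsupp.single a u + Finsupp.single b v + Finsupp.single c w).support ⊆ {a, b, c} := by
  intro x hx
  by_contra h
  simp only [Finset.mem_insert, Finset.mem_singleton, not_or] at h
  simp [Ne.symm h.1, Ne.symm h.2.1, Ne.symm h.2.2] at hx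

/-- The transport attaining the upper price bound: the atom at `1` is sent to `{0, 7/3}` and the
atom at `3` to `{0, 4}`. -/
def optimalTransport : ℝ × ℝ →₀ ℝ :=
  Finsupp.single (1, 0) (1/7) + Finsupp.single (1, 7/3) (3/28)
    + Finsupp.single (7/3, 0) (5/112) + Finsupp.single (7/3, 7/3) (11/28)
    + Finsupp.single (7/3, 4) (1/16) + Finsupp.single (3, 0) (1/16) + Finsupp.single (3, 4) (3/16)

theorem optimalTransport_sum {g : ℝ × ℝ → ℝ → ℝ} (h0 : ∀ p, g p 0 = 0)
    (hadd : ∀ p a b, g p (a + b) = g p a + g p b) :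
    optimalTransport.sum g = g (1, 0) (1/7) + g (1, 7/3) (3/28) + g (7/3, 0) (5/112)
      + g (7/3, 7/3) (11/28) + g (7/3, 4) (1/16) + g (3, 0) (1/16) + g (3, 4) (3/16) := by
  simp only [optimalTransport, Finsupp.sum_add_index' h0 hadd, Finsupp.sum_single_index (h0 _)]

theorem memMart_optimalTransport :
    MemMart
      (Finsupp.single (1 : ℝ) (1/4) + Finsupp.single (7/3 : ℝ) (1/2) + Finsupp.single (3 : ℝ) (1/4))
      (Finsupp.single (0 : ℝ) (1/4) + Finsupp.single (7/3 : ℝ) (1/2) + Finsupp.single (4 : ℝ) (1/4))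
      optimalTransport := by
  refine ⟨fun p => ?_, ?_, fun p hp => ?_, fun x => ?_, fun y => ?_, fun x hx => ?_⟩
  · simp only [optimalTransport, Finsupp.add_apply, Finsupp.single_apply]
    positivity
  · rw [optimalTransport_sum (by simp) (by simp)]
    norm_num
  · by_contra h
    refine Finsupp.mem_support_iff.mp hp ?_
    have hne : ∀ a b : ℝ, 0 ≤ a → 0 ≤ b → (a, b) ≠ p := by
      rintro a b ha hb rfl
      exact h ⟨ha, hb⟩
    simp only [optimalTransport, Finsupp.add_apply, Finsupp.single_apply]
    simp (disch := norm_num) only [if_neg (hne _ _ _ _), add_zero]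
  · simp only [optimalTransport, fstMarg_add, fstMarg_single, Finsupp.add_apply,
      Finsupp.single_apply]
    split_ifs <;> norm_num
  · simp only [optimalTransport, sndMarg_add, sndMarg_single, Finsupp.add_apply,
      Finsupp.single_apply]
    split_ifs <;> norm_num
  · rw [optimalTransport_sum (by simp) fun p a b => by split_ifs <;> ring]
    have hx' := support_three_singles_subset _ _ _ _ _ _ hx
    simp only [Finset.mem_insert, Finset.mem_singleton] at hx'
    rcases hx' with rfl | rfl | rfl <;> norm_num [Finsupp.single_apply]

theorem expPay_optimalTransport :
    expPay optimalTransport (fun x y => x * y ^ 2) = 913 / 54 := by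
  rw [expPay, optimalTransport_sum (by simp) fun p a b => by ring]
  norm_num

theorem expPay_le {Q : ℝ × ℝ →₀ ℝ}
    (h : MemMart
      (Finsupp.single (1 : ℝ) (1/4) + Finsupp.single (7/3 : ℝ) (1/2) + Finsupp.single (3 : ℝ) (1/4))
      (Finsupp.single (0 : ℝ) (1/4) + Finsupp.single (7/3 : ℝ) (1/2) + Finsupp.single (4 : ℝ) (1/4))
      Q) :
    expPay Q (fun x y => x * y ^ 2) ≤ 913 / 54 := by
  have hsum (g : ℝ × ℝ → ℝ → ℝ) (h0 : ∀ p, g p 0 = 0) :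
      Q.sum g = ∑ p ∈ ({1, 7/3, 3} : Finset ℝ) ×ˢ ({0, 7/3, 4} : Finset ℝ), g p (Q p) :=
    Finsupp.sum_of_support_subset Q (h.support_subset.trans (Finset.product_subset_product
      (support_three_singles_subset _ _ _ _ _ _) (support_three_singles_subset _ _ _ _ _ _)))
      g fun p _ => h0 p
  have hsum' (g : ℝ × ℝ → ℝ → ℝ) (h0 : ∀ p, g p 0 = 0) :
      Q.sum g = g (1, 0) (Q (1, 0)) + g (1, 7/3) (Q (1, 7/3)) + g (1, 4) (Q (1, 4))
        + g (7/3, 0) (Q (7/3, 0)) + g (7/3, 7/3) (Q (7/3, 7/3)) + g (7/3, 4) (Q (7/3, 4))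
        + g (3, 0) (Q (3, 0)) + g (3, 7/3) (Q (3, 7/3)) + g (3, 4) (Q (3, 4)) := by
    rw [hsum g h0, Finset.sum_product]
    norm_num [Finset.sum_insert]
    ring
  obtain ⟨hQ, -, -, h₁, h₂, h₃⟩ := h
  have a₁ := h₁ 1
  have a₂ := h₁ (7/3)
  have a₃ := h₁ 3
  have b₂ := h₂ (7/3)
  have c₁ := h₃ 1 (by norm_num [Finsupp.single_apply])
  have c₂ := h₃ (7/3) (by norm_num [Finsupp.single_apply])
  have c₃ := h₃ 3 (by norm_num [Finsupp.single_apply])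
  rw [fstMarg, hsum' _ (by simp)] at a₁ a₂ a₃
  rw [sndMarg, hsum' _ (by simp)] at b₂
  rw [hsum' _ (by simp)] at c₁ c₂ c₃
  norm_num [Finsupp.single_apply] at a₁ a₂ a₃ b₂ c₁ c₂ c₃
  rw [expPay, hsum' _ (by simp)]
  norm_num
  linarith [hQ (1, 4), hQ (3, 7/3)]

theorem convexOrderF_example :
    ConvexOrderF
      (Finsupp.single (1 : ℝ) (1/4) + Finsupp.single (7/3 : ℝ) (1/2) + Finsupp.single (3 : ℝ) (1/4))
      (Finsupp.single (0 : ℝ) (1/4) + Finsupp.single (7/3 : ℝ) (1/2)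
        + Finsupp.single (4 : ℝ) (1/4)) := by
  intro f hf
  have hsum (a b c u v w : ℝ) :
      fintSum (Finsupp.single a u + Finsupp.single b v + Finsupp.single c w) f
        = u * f a + v * f b + w * f c := by
    have h0 (x : ℝ) : (fun x w => w * f x) x 0 = 0 := zero_mul _
    have hadd (x s t : ℝ) : (fun x w => w * f x) x (s + t) = s * f x + t * f x := add_mul s t _
    rw [fintSum, Finsupp.sum_add_index' h0 hadd, Finsupp.sum_add_index' h0 hadd,
      Finsupp.sum_single_index (h0 a), Finsupp.sum_single_index (h0 b),
      Finsupp.sum_single_index (h0 c)]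
  have hc (x y s t : ℝ) (hs : 0 ≤ s) (ht : 0 ≤ t) (hst : s + t = 1) :
      f (s * x + t * y) ≤ s * f x + t * f y := by
    simpa using hf.2 (Set.mem_univ x) (Set.mem_univ y) hs ht hst
  have h₁ := hc 0 (7/3) (4/7) (3/7) (by norm_num) (by norm_num) (by norm_num)
  have h₂ := hc 0 4 (5/12) (7/12) (by norm_num) (by norm_num) (by norm_num)
  have h₃ := hc 0 4 (1/4) (3/4) (by norm_num) (by norm_num) (by norm_num)
  norm_num at h₁ h₂ h₃
  rw [hsum, hsum]
  linarith

/-- for `μ = ¼δ₁ + ½δ_{7/3} + ¼δ₃` and `ν = ¼δ₀ + ½δ_{7/3} + ¼δ₄` one has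
`μ ≤_c ν`, and the upper price bound for the payoff `c(x,y) = x·y²` over all martingale
transports in `M(μ,ν)` equals `913/54`. -/
theorem explicit_upper_price_bound_example
    (μ ν : ℝ →₀ ℝ)
    (hμ : μ = Finsupp.single (1 : ℝ) (1/4) + Finsupp.single (7/3 : ℝ) (1/2)
        + Finsupp.single (3 : ℝ) (1/4))
    (hν : ν = Finsupp.single (0 : ℝ) (1/4) + Finsupp.single (7/3 : ℝ) (1/2)
        + Finsupp.single (4 : ℝ) (1/4)) :
    ConvexOrderF μ ν ∧
    sSup {r : ℝ | ∃ Q : ℝ × ℝ →₀ ℝ, MemMart μ ν Q ∧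
        r = expPay Q (fun x y => x * y ^ 2)} = 913 / 54 := by
  subst hμ hν
  refine ⟨convexOrderF_example, IsGreatest.csSup_eq ⟨?_, ?_⟩⟩
  · exact ⟨optimalTransport, memMart_optimalTransport, expPay_optimalTransport.symm⟩
  · rintro _ ⟨Q, hQ, rfl⟩
    exact expPay_le hQ

end
end
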